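/- Let X ⊂ ℙ^{2n+1} be an OADP variety of dimension n. If X is normal, then X is geometrically linearly normal. -/

import Mathlib

/-!
Basic vocabulary of complex projective algebraic geometry, built on
`Projectivization ℂ (Fin (r+1) → ℂ)` and homogeneous multivariate polynomials.
-/

noncomputable section

open MvPolynomial

/-- Complex projective `r`-space. -/
abbrev Pt (r : ℕ) : Type := Projectivization ℂ (Fin (r + 1) → ℂ)

namespace ProjGeo

variable {r s : ℕ}

/-- A (homogeneous) polynomial vanishes at a point of projective space. -/
def VanishesAt (p : MvPolynomial (Fin (r + 1)) ℂ) (x : Pt r) : Prop :=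
  ∀ (v : Fin (r + 1) → ℂ) (hv : v ≠ 0), Projectivization.mk ℂ v hv = x → eval v p = 0

/-- Common zero locus of a family of polynomials. -/
def ZeroLocus (S : Set (MvPolynomial (Fin (r + 1)) ℂ)) : Set (Pt r) :=
  {x | ∀ p ∈ S, VanishesAt p x}

/-- A subset of projective space is algebraic (Zariski closed) if it is the common
zero locus of a set of homogeneous polynomials. -/
def IsAlgSet (X : Set (Pt r)) : Prop :=
  ∃ S : Set (MvPolynomial (Fin (r + 1)) ℂ),
    (∀ p ∈ S, ∃ d, p.IsHomogeneous d) ∧ X = ZeroLocus S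

/-- Zariski closure. -/
def zcl (A : Set (Pt r)) : Set (Pt r) := ⋂₀ {Y | IsAlgSet Y ∧ A ⊆ Y}

/-- An irreducible (projective) variety: a nonempty algebraic set which is not
contained in the union of two algebraic sets unless it is contained in one of them. -/
def IsIrrVar (X : Set (Pt r)) : Prop :=
  X.Nonempty ∧ IsAlgSet X ∧
    ∀ Y Z : Set (Pt r), IsAlgSet Y → IsAlgSet Z → X ⊆ Y ∪ Z → X ⊆ Y ∨ X ⊆ Z

/-- `DimGE X n` : `X` has dimension at least `n`, measured by chains of irreducible
subvarieties of length `n+1`. -/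
def DimGE (X : Set (Pt r)) (n : ℕ) : Prop :=
  ∃ c : Fin (n + 1) → Set (Pt r),
    (∀ i, IsIrrVar (c i) ∧ c i ⊆ X) ∧ ∀ i j : Fin (n + 1), i < j → c i ⊂ c j

/-- `X` has dimension exactly `n`. -/
def HasDim (X : Set (Pt r)) (n : ℕ) : Prop := DimGE X n ∧ ¬ DimGE X (n + 1)

/-- Local dimension at a point is at least `n`. -/
def DimGEAt (X : Set (Pt r)) (x : Pt r) (n : ℕ) : Prop :=
  ∃ c : Fin (n + 1) → Set (Pt r),
    (∀ i, IsIrrVar (c i) ∧ c i ⊆ X) ∧ x ∈ c 0 ∧ ∀ i j : Fin (n + 1), i < j → c i ⊂ c j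

/-- The linear subspace of projective space associated to a linear subspace `W`. -/
def projSub (W : Submodule ℂ (Fin (r + 1) → ℂ)) : Set (Pt r) :=
  {x | x.submodule ≤ W}

/-- The linear span of a set of points. -/
def projSpan (A : Set (Pt r)) : Submodule ℂ (Fin (r + 1) → ℂ) :=
  ⨆ x ∈ A, x.submodule

/-- Non-degenerate: not contained in any hyperplane. -/
def Nondeg (X : Set (Pt r)) : Prop := projSpan X = ⊤

/-- A property `Q` holds at the general point of `X` : it holds away from some
algebraic set not containing `X`. -/
def Generic (X : Set (Pt r)) (Q : Pt r → Prop) : Prop :=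
  ∃ A : Set (Pt r), IsAlgSet A ∧ ¬ X ⊆ A ∧ ∀ x ∈ X \ A, Q x

/-- The line through two (distinct) points. -/
def lineThrough (x y : Pt r) : Set (Pt r) :=
  projSub (x.submodule ⊔ y.submodule)

/-- `L` is a (proper) secant line of `X`. -/
def SecLine (X : Set (Pt r)) (L : Set (Pt r)) : Prop :=
  ∃ x ∈ X, ∃ y ∈ X, x ≠ y ∧ L = lineThrough x y

/-- The secant variety: Zariski closure of the union of all secant lines. -/
def SecVar (X : Set (Pt r)) : Set (Pt r) :=
  zcl {p | ∃ L, SecLine X L ∧ p ∈ L}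

/-- An irreducible, non-degenerate projective variety of dimension `n`. -/
def IsVariety (n : ℕ) (X : Set (Pt r)) : Prop :=
  IsIrrVar X ∧ HasDim X n ∧ Nondeg X

/-- A variety with one apparent double point: an irreducible non-degenerate,
non secant defective variety `X ⊆ ℙ^{2n+1}` of dimension `n` such that through the
general point of `ℙ^{2n+1}` there passes exactly one secant line of `X`. -/
def IsOADP (n : ℕ) (X : Set (Pt (2 * n + 1))) : Prop :=
  IsVariety n X ∧ SecVar X = Set.univ ∧
    Generic Set.univ (fun p => ∃! L : Set (Pt (2 * n + 1)), SecLine X L ∧ p ∈ L)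

/-- Projective equivalence of two subsets of the same projective space. -/
def ProjEquiv (X Y : Set (Pt r)) : Prop :=
  ∃ g : (Fin (r + 1) → ℂ) ≃ₗ[ℂ] (Fin (r + 1) → ℂ),
    Y = Projectivization.map (g : (Fin (r + 1) → ℂ) →ₗ[ℂ] (Fin (r + 1) → ℂ)) g.injective '' X

end ProjGeo
namespace ProjGeo

variable {r s n : ℕ}

/-- The rational map `ℙ^r ⇢ ℙ^s` induced by a linear map, as a relation between points. -/
def pproj (f : (Fin (r + 1) → ℂ) →ₗ[ℂ] (Fin (s + 1) → ℂ)) (x : Pt r) (y : Pt s) : Prop :=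
  ∃ (v : Fin (r + 1) → ℂ) (hv : v ≠ 0), Projectivization.mk ℂ v hv = x ∧
    ∃ h : f v ≠ 0, y = Projectivization.mk ℂ (f v) h

/-- The rational map given by a tuple of (homogeneous, same degree) polynomials,
as a relation between points. -/
def ratMapRel (F : Fin (s + 1) → MvPolynomial (Fin (r + 1)) ℂ) (x : Pt r) (y : Pt s) : Prop :=
  ∃ (v : Fin (r + 1) → ℂ) (hv : v ≠ 0), Projectivization.mk ℂ v hv = x ∧
    ∃ h : (fun j => MvPolynomial.eval v (F j)) ≠ 0,
      y = Projectivization.mk ℂ (fun j => MvPolynomial.eval v (F j)) h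

/-- Two (sub)varieties are birationally equivalent: there are rational maps, given by
homogeneous polynomials, which are mutually inverse at the general points. -/
def AreBirational (X : Set (Pt r)) (Y : Set (Pt s)) : Prop :=
  ∃ (d e : ℕ) (F : Fin (s + 1) → MvPolynomial (Fin (r + 1)) ℂ)
    (G : Fin (r + 1) → MvPolynomial (Fin (s + 1)) ℂ),
    (∀ j, (F j).IsHomogeneous d) ∧ (∀ i, (G i).IsHomogeneous e) ∧
    (∃ A, IsAlgSet A ∧ ¬ X ⊆ A ∧
      ∀ x ∈ X \ A, ∃ y ∈ Y, ratMapRel F x y ∧ ratMapRel G y x) ∧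
    (∃ B, IsAlgSet B ∧ ¬ Y ⊆ B ∧
      ∀ y ∈ Y \ B, ∃ x ∈ X, ratMapRel G y x ∧ ratMapRel F x y)

/-- A variety is rational if it is birational to `ℙ^n`. -/
def IsRationalVar (n : ℕ) (X : Set (Pt r)) : Prop :=
  AreBirational X (Set.univ : Set (Pt n))

/-- The homogeneous ideal (as a set of homogeneous polynomials) of a set. -/
def homIdeal (X : Set (Pt r)) : Set (MvPolynomial (Fin (r + 1)) ℂ) :=
  {p | (∃ d, p.IsHomogeneous d) ∧ ∀ x ∈ X, VanishesAt p x}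

/-- Directional derivative of a polynomial at `v` in direction `w`. -/
def diffAt (p : MvPolynomial (Fin (r + 1)) ℂ) (v w : Fin (r + 1) → ℂ) : ℂ :=
  ∑ i, w i * MvPolynomial.eval v (MvPolynomial.pderiv i p)

/-- The (cone over the) embedded projective tangent space of `X` at `x`: the common kernel
of the differentials at `x` of all elements of the homogeneous ideal of `X`. -/
def embTangent (X : Set (Pt r)) (x : Pt r) : Submodule ℂ (Fin (r + 1) → ℂ) :=
  ⨅ p ∈ homIdeal X,
    LinearMap.ker (∑ i, MvPolynomial.eval x.rep (MvPolynomial.pderiv i p) •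
      (LinearMap.proj i : (Fin (r + 1) → ℂ) →ₗ[ℂ] ℂ))

/-- `X` (of dimension `n`) is smooth: at each of its points the embedded tangent
space has the expected dimension. -/
def SmoothOfDim (n : ℕ) (X : Set (Pt r)) : Prop :=
  ∀ x ∈ X, Module.finrank ℂ (embTangent X x) = n + 1

/-- The linear projection induced by `f` restricts to a birational map from `X`
onto `ℙ^n`: it is dominant and generically injective on `X`. -/
def BirationalProjTo (n : ℕ) (f : (Fin (r + 1) → ℂ) →ₗ[ℂ] (Fin (n + 1) → ℂ))
    (X : Set (Pt r)) : Prop :=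
  zcl {y | ∃ x ∈ X, pproj f x y} = Set.univ ∧
  ∃ A, IsAlgSet A ∧ ¬ X ⊆ A ∧
    ∀ x₁ ∈ X \ A, ∀ x₂ ∈ X \ A, ∀ y, pproj f x₁ y → pproj f x₂ y → x₁ = x₂

/-- `f` realizes the tangential projection of `X ⊆ ℙ^{2n+1}` at `x`: it is the linear
projection from the embedded tangent space at `x` onto `ℙ^n`. -/
def TangentProjection (n : ℕ) (X : Set (Pt (2 * n + 1))) (x : Pt (2 * n + 1))
    (f : (Fin (2 * n + 2) → ℂ) →ₗ[ℂ] (Fin (n + 1) → ℂ)) : Prop :=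
  Function.Surjective f ∧ LinearMap.ker f = embTangent X x

/-- A Bronowski variety: an irreducible non-degenerate `n`-dimensional variety
`X ⊆ ℙ^{2n+1}` whose tangential projection at the general point is birational onto `ℙ^n`. -/
def IsBronowski (n : ℕ) (X : Set (Pt (2 * n + 1))) : Prop :=
  IsVariety n X ∧
  Generic X (fun x =>
    Module.finrank ℂ (embTangent X x) = n + 1 ∧
    ∀ f, TangentProjection n X x f → BirationalProjTo n f X)

end ProjGeo
namespace ProjGeo

variable {r : ℕ}

/-- The homogeneous coordinate ring of (the affine cone over) `X`. -/
def coneRing (X : Set (Pt r)) : Type :=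
  MvPolynomial (Fin (r + 1)) ℂ ⧸ Ideal.span (homIdeal X)

noncomputable instance (X : Set (Pt r)) : CommRing (coneRing X) :=
  Ideal.Quotient.commRing _

/-- `X` is a normal variety: the local ring of the affine cone over `X` at every prime
away from the vertex (i.e. not containing the irrelevant ideal) is integrally closed
in its total fraction ring. -/
def IsNormalVar (X : Set (Pt r)) : Prop :=
  ∀ (P : Ideal (coneRing X)) (hP : P.IsPrime),
    (∃ i : Fin (r + 1),
        Ideal.Quotient.mk (Ideal.span (homIdeal X)) (MvPolynomial.X i) ∉ P) →
    integralClosure (Localization (@Ideal.primeCompl _ _ P hP))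
      (FractionRing (Localization (@Ideal.primeCompl _ _ P hP))) = ⊥

end ProjGeo
namespace ProjGeo

variable {r' r : ℕ}

/-- The linear projection induced by `f` restricts on `X'` to a (finite) birational
morphism onto `X`: it is everywhere defined on `X'`, has image `X`, and is
generically injective. -/
def InducesBirMorphismOnto (f : (Fin (r' + 1) → ℂ) →ₗ[ℂ] (Fin (r + 1) → ℂ))
    (X' : Set (Pt r')) (X : Set (Pt r)) : Prop :=
  (∀ x ∈ X', ∀ (v : Fin (r' + 1) → ℂ) (hv : v ≠ 0),
    Projectivization.mk ℂ v hv = x → f v ≠ 0) ∧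
  {y | ∃ x ∈ X', pproj f x y} = X ∧
  ∃ A, IsAlgSet A ∧ ¬ X' ⊆ A ∧
    ∀ x₁ ∈ X' \ A, ∀ x₂ ∈ X' \ A, ∀ y, pproj f x₁ y → pproj f x₂ y → x₁ = x₂

/-- The linear projection induces an isomorphism from `X'` onto `X`: a birational
morphism which is moreover injective and injective on embedded tangent spaces. -/
def InducesIsoOnto (f : (Fin (r' + 1) → ℂ) →ₗ[ℂ] (Fin (r + 1) → ℂ))
    (X' : Set (Pt r')) (X : Set (Pt r)) : Prop :=
  InducesBirMorphismOnto f X' X ∧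
  (∀ x₁ ∈ X', ∀ x₂ ∈ X', ∀ y, pproj f x₁ y → pproj f x₂ y → x₁ = x₂) ∧
  ∀ x ∈ X', Disjoint (LinearMap.ker f) (embTangent X' x)

/-- `X ⊂ ℙ^r` is geometrically linearly normal: it is not the birational linear
projection of an irreducible non-degenerate variety spanning a larger projective space. -/
def GeomLinearlyNormal (X : Set (Pt r)) : Prop :=
  ∀ r' : ℕ, r < r' → ∀ X' : Set (Pt r'), IsIrrVar X' → Nondeg X' →
    ∀ f : (Fin (r' + 1) → ℂ) →ₗ[ℂ] (Fin (r + 1) → ℂ), Function.Surjective f →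
      ¬ InducesBirMorphismOnto f X' X

/-- `X ⊂ ℙ^r` is linearly normal: it is not an isomorphic linear projection of a
variety spanning a larger projective space. -/
def LinearlyNormal (X : Set (Pt r)) : Prop :=
  ∀ r' : ℕ, r < r' → ∀ X' : Set (Pt r'), IsIrrVar X' → Nondeg X' →
    ∀ f : (Fin (r' + 1) → ℂ) →ₗ[ℂ] (Fin (r + 1) → ℂ), Function.Surjective f →
      ¬ InducesIsoOnto f X' X

end ProjGeo

/-!
STATEMENT 4: Let `X ⊂ ℙ^{2n+1}` be an OADP variety of dimension `n`. If `X` is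
normal, then `X` is geometrically linearly normal.
-/

section
namespace ProjGeo

/-- The affine cone. -/
def Cone {r : ℕ} (X : Set (Pt r)) : Set (Fin (r + 1) → ℂ) :=
  {v | ∀ h : v ≠ 0, Projectivization.mk ℂ v h ∈ X}

variable {r : ℕ} {X : Set (Pt r)}

lemma zero_mem_Cone : (0 : Fin (r + 1) → ℂ) ∈ Cone X := fun h => absurd rfl h

lemma smul_mem_Cone {v : Fin (r + 1) → ℂ} (hv : v ∈ Cone X) (c : ℂ) : c • v ∈ Cone X := by
  intro h
  have hv0 : v ≠ 0 := by rintro rfl; simp at h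
  have hc : c ≠ 0 := by rintro rfl; simp at h
  have : Projectivization.mk ℂ (c • v) h = Projectivization.mk ℂ v hv0 := by
    rw [Projectivization.mk_eq_mk_iff']
    exact ⟨c, rfl⟩
  rw [this]
  exact hv hv0

lemma eval_smul_of_homog {p : MvPolynomial (Fin (r + 1)) ℂ} {d : ℕ} (hp : p.IsHomogeneous d)
    (c : ℂ) (v : Fin (r + 1) → ℂ) : eval (c • v) p = c ^ d * eval v p := by
  rw [MvPolynomial.eval_eq, MvPolynomial.eval_eq, Finset.mul_sum]
  refine Finset.sum_congr rfl fun m hm => ?_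
  have h := hp (mem_support_iff.mp hm)
  rw [← h]
  simp only [Pi.smul_apply, smul_eq_mul, mul_pow, Finset.prod_mul_distrib, Finset.prod_pow_eq_pow_sum]
  rw [show (Finsupp.weight 1) m = ∑ i ∈ m.support, m i by
    simp [Finsupp.weight_apply, Finsupp.sum]]
  ring

lemma vanishesAt_iff {p : MvPolynomial (Fin (r + 1)) ℂ} {d : ℕ} (hp : p.IsHomogeneous d)
    (v : Fin (r + 1) → ℂ) (hv : v ≠ 0) :
    VanishesAt p (Projectivization.mk ℂ v hv) ↔ eval v p = 0 := by
  constructor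
  · intro h; exact h v hv rfl
  · intro h w hw hwv
    rw [Projectivization.mk_eq_mk_iff'] at hwv
    obtain ⟨a, rfl⟩ := hwv
    rw [eval_smul_of_homog hp, h, mul_zero]

/-- polynomial in t : `g (t v)`; if it vanishes for all t≠0 then all components vanish. -/
lemma comps_vanish {g : MvPolynomial (Fin (r + 1)) ℂ} {v : Fin (r + 1) → ℂ}
    (h : ∀ t : ℂ, eval (t • v) g = 0) (d : ℕ) : eval v (homogeneousComponent d g) = 0 := by
  let P : Polynomial ℂ := ∑ i ∈ Finset.range (g.totalDegree + 1),
    Polynomial.C (eval v (homogeneousComponent i g)) * Polynomial.X ^ i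
  have hP : P = 0 := by
    apply Polynomial.funext
    intro t
    have := h t
    rw [← sum_homogeneousComponent g, map_sum] at this
    simp only [P, Polynomial.eval_finsetSum, Polynomial.eval_mul, Polynomial.eval_C,
      Polynomial.eval_pow, Polynomial.eval_X, Polynomial.eval_zero]
    rw [← this]
    refine Finset.sum_congr rfl fun i _ => ?_
    rw [eval_smul_of_homog (homogeneousComponent_isHomogeneous i g)]
    ring
  by_cases hd : d < g.totalDegree + 1
  · have := congrArg (fun Q => Polynomial.coeff Q d) hP
    simpa [P, Polynomial.finsetSum_coeff, Polynomial.coeff_C_mul, Polynomial.coeff_X_pow,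
      hd] using this
  · rw [homogeneousComponent_eq_zero _ _ (by omega)]; simp

lemma eval_eq_sum_smul (g : MvPolynomial (Fin (r + 1)) ℂ) (v : Fin (r + 1) → ℂ) (t : ℂ) :
    eval (t • v) g = ∑ i ∈ Finset.range (g.totalDegree + 1),
      t ^ i * eval v (homogeneousComponent i g) := by
  conv_lhs => rw [← sum_homogeneousComponent g, map_sum]
  exact Finset.sum_congr rfl fun i _ =>
    eval_smul_of_homog (homogeneousComponent_isHomogeneous i g) _ _

abbrev II (X : Set (Pt r)) : Ideal (MvPolynomial (Fin (r + 1)) ℂ) := Ideal.span (homIdeal X)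

lemma mem_X_iff_rep (x : Pt r) : x ∈ X ↔ x.rep ∈ Cone X := by
  constructor
  · intro h _; rwa [Projectivization.mk_rep]
  · intro h; have := h x.rep_nonzero; rwa [Projectivization.mk_rep] at this

lemma exists_ne_zero_mem_Cone (hX : X.Nonempty) : ∃ v ∈ Cone X, v ≠ 0 := by
  obtain ⟨x, hx⟩ := hX
  exact ⟨x.rep, (mem_X_iff_rep x).1 hx, x.rep_nonzero⟩

lemma homIdeal_eval (hX : X.Nonempty) {g : MvPolynomial (Fin (r + 1)) ℂ} (hg : g ∈ homIdeal X)
    {v : Fin (r + 1) → ℂ} (hv : v ∈ Cone X) : eval v g = 0 := by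
  obtain ⟨⟨d, hd⟩, h⟩ := hg
  by_cases hv0 : v = 0
  · subst hv0
    obtain ⟨w, hw, hw0⟩ := exists_ne_zero_mem_Cone hX
    have h1 : eval w g = 0 := (vanishesAt_iff hd w hw0).1 (h _ (hw hw0))
    have := eval_smul_of_homog hd 0 w
    rw [zero_smul, h1, mul_zero] at this
    exact this
  · exact (vanishesAt_iff hd v hv0).1 (h _ (hv hv0))

lemma mem_II_iff (hX : X.Nonempty) (g : MvPolynomial (Fin (r + 1)) ℂ) :
    g ∈ II X ↔ ∀ v ∈ Cone X, eval v g = 0 := by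
  constructor
  · intro hg v hv
    have : II X ≤ RingHom.ker (eval v) := by
      rw [Ideal.span_le]
      intro q hq
      exact homIdeal_eval hX hq hv
    exact this hg
  · intro h
    rw [← sum_homogeneousComponent g]
    refine Ideal.sum_mem _ fun i _ => Ideal.subset_span ⟨⟨i, homogeneousComponent_isHomogeneous i g⟩, ?_⟩
    intro x hx v hv hvx
    subst hvx
    apply comps_vanish
    intro t
    exact h _ (smul_mem_Cone (fun _ => hx) t)

lemma mem_Cone_of_II (hX : IsAlgSet X) {v : Fin (r + 1) → ℂ} (h : ∀ g ∈ II X, eval v g = 0) :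
    v ∈ Cone X := by
  obtain ⟨S, hS, rfl⟩ := hX
  intro hv p hp
  obtain ⟨d, hd⟩ := hS p hp
  rw [vanishesAt_iff hd]
  exact h p (Ideal.subset_span ⟨⟨d, hd⟩, fun x hx => hx p hp⟩)

lemma II_isPrime (hX : IsIrrVar X) : (II X).IsPrime := by
  obtain ⟨hne, halg, hirr⟩ := hX
  refine ⟨?_, ?_⟩
  · rw [Ideal.ne_top_iff_one, mem_II_iff hne]
    intro h
    simpa using h 0 zero_mem_Cone
  · intro g k hgk
    rw [mem_II_iff hne] at hgk
    let Zs : MvPolynomial (Fin (r + 1)) ℂ → Set (Pt r) := fun q =>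
      ZeroLocus (Set.range fun d => homogeneousComponent d q)
    have hZ : ∀ q, IsAlgSet (Zs q) := fun q => ⟨_, by
      rintro _ ⟨d, rfl⟩
      exact ⟨d, homogeneousComponent_isHomogeneous d q⟩, rfl⟩
    have key : ∀ q, X ⊆ Zs q → q ∈ II X := by
      intro q hq
      rw [← sum_homogeneousComponent q]
      exact Ideal.sum_mem _ fun i _ => Ideal.subset_span
        ⟨⟨i, homogeneousComponent_isHomogeneous i q⟩, fun x hx => hq hx _ ⟨i, rfl⟩⟩
    refine (hirr (Zs g) (Zs k) (hZ g) (hZ k) ?_).imp (key g) (key k)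
    intro x hx
    have hxr := (mem_X_iff_rep x).1 hx
    let PP : MvPolynomial (Fin (r + 1)) ℂ → Polynomial ℂ := fun q =>
      ∑ i ∈ Finset.range (q.totalDegree + 1),
        Polynomial.C (eval x.rep (homogeneousComponent i q)) * Polynomial.X ^ i
    have hPP : ∀ q t, (PP q).eval t = eval (t • x.rep) q := by
      intro q t
      rw [eval_eq_sum_smul]
      simp only [PP, Polynomial.eval_finsetSum, Polynomial.eval_mul, Polynomial.eval_C,
        Polynomial.eval_pow, Polynomial.eval_X]
      exact Finset.sum_congr rfl fun i _ => mul_comm _ _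
    have hprod : PP g * PP k = 0 := by
      apply Polynomial.funext
      intro t
      rw [Polynomial.eval_mul, hPP, hPP, ← map_mul, hgk _ (smul_mem_Cone hxr t)]
      simp
    have key2 : ∀ q, PP q = 0 → x ∈ Zs q := by
      intro q hq
      rintro _ ⟨d, rfl⟩
      rw [← Projectivization.mk_rep x, vanishesAt_iff (homogeneousComponent_isHomogeneous d q)]
      apply comps_vanish
      intro t
      rw [← hPP, hq]; simp
    exact (mul_eq_zero.1 hprod).imp (key2 g) (key2 k)

lemma isClosed_Cone (hne : X.Nonempty) (hX : IsAlgSet X) : IsClosed (Cone X) := by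
  have : Cone X = ⋂ g ∈ II X, {v | eval v g = 0} := by
    ext v
    simp only [Set.mem_iInter, Set.mem_ofPred_eq]
    exact ⟨fun hv g hg => (mem_II_iff hne g).1 hg v hv, mem_Cone_of_II hX⟩
  rw [this]
  refine isClosed_biInter fun g _ => isClosed_eq (MvPolynomial.continuous_eval g) continuous_const

end ProjGeo
end

section
namespace ProjGeo

lemma exists_algHom_of_field (L : Type*) [Field L] [Algebra ℂ L] [Algebra.FiniteType ℂ L] :
    Nonempty (L →ₐ[ℂ] ℂ) := by
  haveI : Module.Finite ℂ L := finite_of_finite_type_of_isJacobsonRing _ _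
  exact ⟨IsAlgClosed.lift (M := ℂ) (R := ℂ) (S := L)⟩

lemma spec_exists {Ω : Type*} [Field Ω] [Algebra ℂ Ω] (T : Set Ω) (hT : T.Finite) :
    ∃ B : Subalgebra ℂ Ω, T ⊆ B ∧ Nonempty (B →ₐ[ℂ] ℂ) := by
  refine ⟨Algebra.adjoin ℂ T, Algebra.subset_adjoin, ?_⟩
  haveI : Algebra.FiniteType ℂ (Algebra.adjoin ℂ T) :=
    (Subalgebra.fg_iff_finiteType _).1 ⟨hT.toFinset, by simp⟩
  obtain ⟨m, hm⟩ := Ideal.exists_maximal (Algebra.adjoin ℂ T)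
  letI : Field ((Algebra.adjoin ℂ T) ⧸ m) := Ideal.Quotient.field m
  haveI : Algebra.FiniteType ℂ ((Algebra.adjoin ℂ T) ⧸ m) :=
    Algebra.FiniteType.of_surjective (Ideal.Quotient.mkₐ ℂ m)
      Ideal.Quotient.mk_surjective
  obtain ⟨e⟩ := exists_algHom_of_field ((Algebra.adjoin ℂ T) ⧸ m)
  exact ⟨e.comp (Ideal.Quotient.mkₐ ℂ m)⟩

lemma exists_dual {Ω : Type*} [Field Ω] {m N : ℕ} (u : Fin m → Fin N → Ω)
    (hu : LinearIndependent Ω u) :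
    ∃ G : Fin m → Fin N → Ω, ∀ i j, ∑ k, G i k * u j k = if i = j then 1 else 0 := by
  have hinj : LinearMap.ker (Fintype.linearCombination Ω u) = ⊥ := by
    rw [LinearMap.ker_eq_bot]
    exact hu.fintypeLinearCombination_injective
  obtain ⟨g, hg⟩ := LinearMap.exists_leftInverse_of_injective _ hinj
  refine ⟨fun i k => g (Pi.single k 1) i, fun i j => ?_⟩
  have h1 : g (u j) = Pi.single j 1 := by
    have := LinearMap.congr_fun hg (Pi.single j 1)
    simpa [Fintype.linearCombination_apply_single] using this
  have h2 : u j = ∑ k, u j k • (Pi.single k 1 : Fin N → Ω) := by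
    ext l; simp [Finset.sum_apply, Pi.single_apply]
  have h3 : g (u j) i = ∑ k, g (Pi.single k 1) i * u j k := by
    conv_lhs => rw [h2]
    simp [Finset.sum_apply, mul_comm]
  rw [← h3, h1, Pi.single_apply]

lemma indep_of_dual {Ω : Type*} [Field Ω] {m N : ℕ} (u : Fin m → Fin N → Ω)
    (G : Fin m → Fin N → Ω) (h : ∀ i j, ∑ k, G i k * u j k = if i = j then 1 else 0) :
    LinearIndependent Ω u := by
  rw [Fintype.linearIndependent_iff]
  intro c hc i
  have : ∑ k, G i k * (∑ j, c j • u j) k = 0 := by rw [hc]; simp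
  simp only [Finset.sum_apply, Pi.smul_apply, smul_eq_mul, Finset.mul_sum] at this
  rw [Finset.sum_comm] at this
  have h2 : ∀ j, ∑ k, G i k * (c j * u j k) = c j * if i = j then 1 else 0 := by
    intro j
    rw [← h, Finset.mul_sum]
    exact Finset.sum_congr rfl fun k _ => by ring
  simpa [h2] using this

/-- specialization of points in an algebra -/
lemma aeval_spec {Ω : Type*} [Field Ω] [Algebra ℂ Ω] {N : ℕ} {B : Subalgebra ℂ Ω} (θ : B →ₐ[ℂ] ℂ)
    (v : Fin N → B) (g : MvPolynomial (Fin N) ℂ) :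
    eval (fun i => θ (v i)) g = θ (aeval v g) ∧ ((aeval v g : B) : Ω) = aeval (fun i => (v i : Ω)) g := by
  constructor
  · rw [← MvPolynomial.coe_aeval_eq_eval]
    change aeval (fun i => θ (v i)) g = _
    rw [← MvPolynomial.comp_aeval_apply]
  · exact MvPolynomial.comp_aeval_apply v B.val g

/-- Points of the cone with values in an algebra. -/
def PtOver {r : ℕ} (X : Set (Pt r)) {Ω : Type*} [CommRing Ω] [Algebra ℂ Ω] (v : Fin (r + 1) → Ω) :
    Prop := ∀ g ∈ II X, aeval v g = 0

lemma PtOver.spec {r : ℕ} {X : Set (Pt r)} (hX : IsAlgSet X) {Ω : Type*} [Field Ω] [Algebra ℂ Ω]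
    {B : Subalgebra ℂ Ω} (θ : B →ₐ[ℂ] ℂ)
    (v : Fin (r + 1) → B) (hv : PtOver X (fun i => (v i : Ω))) :
    (fun i => θ (v i)) ∈ Cone X := by
  apply mem_Cone_of_II hX
  intro g hg
  obtain ⟨h1, h2⟩ := aeval_spec θ v g
  rw [hv g hg] at h2
  rw [h1, show aeval v g = 0 from Subtype.ext h2, map_zero]

lemma mk_mem_lineThrough {r : ℕ} {v w p : Fin (r + 1) → ℂ} (hv : v ≠ 0) (hw : w ≠ 0) (hp : p ≠ 0) :
    Projectivization.mk ℂ p hp ∈ lineThrough (Projectivization.mk ℂ v hv) (Projectivization.mk ℂ w hw)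
      ↔ p ∈ Submodule.span ℂ {v, w} := by
  change (Projectivization.mk ℂ p hp).submodule ≤ _ ↔ _
  rw [Projectivization.submodule_mk, Projectivization.submodule_mk, Projectivization.submodule_mk,
    Submodule.span_singleton_le_iff_mem, ← Submodule.span_union]
  rfl

/-- The uniqueness property of general secant lines, in terms of a polynomial. -/
def UniqueSec {r : ℕ} (X : Set (Pt r)) (h : MvPolynomial (Fin (r + 1)) ℂ) : Prop :=
  ∀ (p : Fin (r + 1) → ℂ) (hp : p ≠ 0), eval p h ≠ 0 →
    ∃! L : Set (Pt r), SecLine X L ∧ Projectivization.mk ℂ p hp ∈ L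

lemma UniqueSec.of_points {r : ℕ} {X : Set (Pt r)} {h : MvPolynomial (Fin (r + 1)) ℂ}
    (hu : UniqueSec X h) {v w v2 w2 : Fin (r + 1) → ℂ} (hv : v ∈ Cone X) (hw : w ∈ Cone X)
    (hv2 : v2 ∈ Cone X) (hw2 : w2 ∈ Cone X) (hs : v + w = v2 + w2)
    (hh : eval (v + w) h ≠ 0) (h1 : LinearIndependent ℂ ![v, w])
    (h2 : LinearIndependent ℂ ![v2, w2]) : v2 ∈ Submodule.span ℂ {v, w} := by
  have ne : ∀ {a b : Fin (r + 1) → ℂ}, LinearIndependent ℂ ![a, b] →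
      ∃ (ha : a ≠ 0) (hb : b ≠ 0), a + b ≠ 0 ∧
        Projectivization.mk ℂ a ha ≠ Projectivization.mk ℂ b hb := by
    intro a b hab
    have ha : a ≠ 0 := hab.ne_zero 0
    have hb : b ≠ 0 := hab.ne_zero 1
    refine ⟨ha, hb, ?_, ?_⟩
    · rw [LinearIndependent.pair_iff] at hab
      intro h0
      have := (hab 1 1 (by simpa using h0)).1
      simp at this
    · intro he
      rw [Projectivization.mk_eq_mk_iff'] at he
      obtain ⟨c, hc⟩ := he
      rw [LinearIndependent.pair_iff] at hab
      have := (hab 1 (-c) (by rw [hc.symm]; simp)).1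
      simp at this
  obtain ⟨hv0, hw0, hp0, hne⟩ := ne h1
  obtain ⟨hv20, hw20, -, hne2⟩ := ne h2
  have hL := (hu (v + w) hp0 hh).unique
    (y₁ := lineThrough (Projectivization.mk ℂ v hv0) (Projectivization.mk ℂ w hw0))
    (y₂ := lineThrough (Projectivization.mk ℂ v2 hv20) (Projectivization.mk ℂ w2 hw20))
    ⟨⟨_, hv hv0, _, hw hw0, hne, rfl⟩, by
      rw [mk_mem_lineThrough]
      exact Submodule.add_mem _ (Submodule.subset_span (by simp)) (Submodule.subset_span (by simp))⟩
    ⟨⟨_, hv2 hv20, _, hw2 hw20, hne2, rfl⟩, by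
      rw [mk_mem_lineThrough, hs]
      exact Submodule.add_mem _ (Submodule.subset_span (by simp)) (Submodule.subset_span (by simp))⟩
  rw [← mk_mem_lineThrough hv0 hw0 hv20, hL, mk_mem_lineThrough]
  exact Submodule.subset_span (by simp)

lemma UniqueSec.generic {r : ℕ} {X : Set (Pt r)} (hX : IsAlgSet X)
    {h : MvPolynomial (Fin (r + 1)) ℂ}
    (hu : UniqueSec X h) {Ω : Type*} [Field Ω] [Algebra ℂ Ω]
    {v w v2 w2 : Fin (r + 1) → Ω} (hv : PtOver X v) (hw : PtOver X w)
    (hv2 : PtOver X v2) (hw2 : PtOver X w2) (hs : v + w = v2 + w2)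
    (hh : aeval (v + w) h ≠ 0) (h1 : LinearIndependent Ω ![v, w])
    (h2 : LinearIndependent Ω ![v2, w2]) : ∃ a b : Ω, v2 = a • v + b • w := by
  by_contra hcon
  have h3 : LinearIndependent Ω ![v2, v, w] := by
    refine linearIndependent_finCons.2 ⟨h1, fun hmem => hcon ?_⟩
    rw [show Set.range ![v, w] = {v, w} by simp [Matrix.range_cons, Set.pair_comm],
      Submodule.mem_span_pair] at hmem
    obtain ⟨a, b, hab⟩ := hmem
    exact ⟨a, b, hab.symm⟩
  obtain ⟨G2, hG2⟩ := exists_dual _ h2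
  obtain ⟨G3, hG3⟩ := exists_dual _ h3
  let y : Ω := (aeval (v + w) h)⁻¹
  let T : Set Ω := Set.range v ∪ Set.range w ∪ Set.range v2 ∪ Set.range w2 ∪
    (Set.range fun x : Fin 2 × Fin (r + 1) => G2 x.1 x.2) ∪
    (Set.range fun x : Fin 3 × Fin (r + 1) => G3 x.1 x.2) ∪ {y}
  have hT : T.Finite := by
    simp only [T, Set.finite_union, Set.finite_singleton, Set.finite_range, and_true]
  obtain ⟨B, hTB, ⟨θ⟩⟩ := spec_exists T hT
  have m1 : ∀ i, v i ∈ B := fun i => hTB (by simp [T])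
  have m2 : ∀ i, w i ∈ B := fun i => hTB (by simp [T])
  have m3 : ∀ i, v2 i ∈ B := fun i => hTB (by simp [T])
  have m4 : ∀ i, w2 i ∈ B := fun i => hTB (by simp [T])
  have m5 : ∀ i j, G2 i j ∈ B := fun i j =>
    hTB (Or.inl (Or.inl (Or.inr ⟨(i, j), rfl⟩)))
  have m6 : ∀ i j, G3 i j ∈ B := fun i j => hTB (Or.inl (Or.inr ⟨(i, j), rfl⟩))
  have m7 : y ∈ B := hTB (by simp [T])
  let v' : Fin (r + 1) → B := fun i => ⟨v i, m1 i⟩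
  let w' : Fin (r + 1) → B := fun i => ⟨w i, m2 i⟩
  let v2' : Fin (r + 1) → B := fun i => ⟨v2 i, m3 i⟩
  let w2' : Fin (r + 1) → B := fun i => ⟨w2 i, m4 i⟩
  let G2' : Fin 2 → Fin (r + 1) → B := fun i j => ⟨G2 i j, m5 i j⟩
  let G3' : Fin 3 → Fin (r + 1) → B := fun i j => ⟨G3 i j, m6 i j⟩
  have e2 : LinearIndependent ℂ ![fun i => θ (v2' i), fun i => θ (w2' i)] := by
    apply indep_of_dual _ (fun i j => θ (G2' i j))
    intro i j
    have := hG2 i j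
    have h' : ∑ k, G2' i k * (![v2', w2'] j k) = if i = j then 1 else 0 := by
      apply Subtype.ext
      rw [AddSubmonoidClass.coe_finsetSum]
      fin_cases j <;> fin_cases i <;> simpa using this
    have h'' := congrArg θ h'
    rw [map_sum] at h''
    fin_cases j <;> fin_cases i <;> simpa using h''
  have e3 : LinearIndependent ℂ ![fun i => θ (v2' i), fun i => θ (v' i), fun i => θ (w' i)] := by
    apply indep_of_dual _ (fun i j => θ (G3' i j))
    intro i j
    have := hG3 i j
    have h' : ∑ k, G3' i k * (![v2', v', w'] j k) = if i = j then 1 else 0 := by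
      apply Subtype.ext
      rw [AddSubmonoidClass.coe_finsetSum]
      fin_cases j <;> fin_cases i <;> simpa using this
    have h'' := congrArg θ h'
    rw [map_sum] at h''
    fin_cases j <;> fin_cases i <;> simpa using h''
  replace e3 := linearIndependent_finCons.1 e3
  refine e3.2 ?_
  rw [show Set.range ![fun i => θ (v' i), fun i => θ (w' i)] =
      {fun i => θ (v' i), fun i => θ (w' i)} by simp [Matrix.range_cons, Set.pair_comm]]
  refine hu.of_points (hv.spec hX θ v') (hw.spec hX θ w') (hv2.spec hX θ v2')
    (hw2.spec hX θ w2') ?_ ?_ e3.1 e2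
  · ext i
    simp only [Pi.add_apply, ← map_add]
    congr 1
    exact Subtype.ext (congrFun hs i)
  · have hsum : (fun i => θ (v' i)) + (fun i => θ (w' i)) = fun i => θ (v' i + w' i) := by
      ext i; simp
    rw [hsum, (aeval_spec θ (fun i => v' i + w' i) h).1]
    have hc := (aeval_spec θ (fun i => v' i + w' i) h).2
    have : (aeval (fun i => v' i + w' i) h : B) * ⟨y, m7⟩ = 1 := by
      apply Subtype.ext
      rw [MulMemClass.coe_mul, hc]
      exact mul_inv_cancel₀ hh
    intro h0
    have h9 := congrArg θ this
    rw [map_mul, h0, map_one] at h9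
    simp at h9

end ProjGeo
end

section
namespace ProjGeo

/-- Extension of derivations along algebraic extensions, char 0. -/
lemma deriv_lift {A Ω : Type*} [CommRing A] [IsDomain A] [Algebra ℂ A] [Field Ω] [Algebra ℂ Ω]
    [Algebra A Ω] [IsScalarTower ℂ A Ω] [FaithfulSMul A Ω] [Algebra.IsAlgebraic A Ω] :
    (∀ d : Derivation ℂ A Ω, ∃ D : Derivation ℂ Ω Ω, ∀ a, D (algebraMap A Ω a) = d a) ∧
    ∀ D : Derivation ℂ Ω Ω, (∀ a, D (algebraMap A Ω a) = 0) → D = 0 := by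
  letI : Algebra (FractionRing A) Ω := FractionRing.liftAlgebra A Ω
  haveI : IsScalarTower A (FractionRing A) Ω := FractionRing.isScalarTower_liftAlgebra A Ω
  haveI : Algebra.FormallyEtale A (FractionRing A) := .of_isLocalization (nonZeroDivisors A)
  haveI : CharZero (FractionRing A) := by
    haveI : CharZero A := charZero_of_injective_algebraMap (algebraMap ℂ A).injective
    exact charZero_of_injective_algebraMap (IsFractionRing.injective A (FractionRing A))
  haveI : Algebra.IsAlgebraic (FractionRing A) Ω :=
    Algebra.IsAlgebraic.extendScalars (R := A) (IsFractionRing.injective A (FractionRing A))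
  haveI : Algebra.FormallyEtale (FractionRing A) Ω := Algebra.FormallyEtale.of_isSeparable _ _
  haveI : Algebra.FormallyEtale A Ω := .comp A (FractionRing A) Ω
  let e := KaehlerDifferential.tensorKaehlerEquivOfFormallyEtale ℂ A Ω
  constructor
  · intro d
    let φ : KaehlerDifferential ℂ A →ₗ[A] Ω := d.liftKaehlerDifferential
    let ψ : TensorProduct A Ω (KaehlerDifferential ℂ A) →ₗ[Ω] Ω :=
      TensorProduct.AlgebraTensorModule.lift
        ((LinearMap.toSpanSingleton Ω (KaehlerDifferential ℂ A →ₗ[A] Ω) φ))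
    refine ⟨(KaehlerDifferential.linearMapEquivDerivation ℂ Ω) (ψ ∘ₗ e.symm.toLinearMap), ?_⟩
    intro a
    change ψ (e.symm (KaehlerDifferential.D ℂ Ω (algebraMap A Ω a))) = _
    rw [KaehlerDifferential.tensorKaehlerEquivOfFormallyEtale_symm_D_algebraMap]
    simp [ψ, φ]
  · intro D hD
    have h : D.liftKaehlerDifferential = 0 := by
      have : D.liftKaehlerDifferential ∘ₗ e.toLinearMap = 0 := by
        apply LinearMap.ext
        intro x
        induction x using TensorProduct.induction_on with
        | zero => simp
        | add x y hx hy => rw [map_add, hx, hy]; simp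
        | tmul t y =>
          obtain ⟨y', rfl⟩ : ∃ y', y' = y := ⟨y, rfl⟩
          have hy : y' ∈ Submodule.span A (Set.range (KaehlerDifferential.D ℂ A)) := by
            rw [KaehlerDifferential.span_range_derivation]; trivial
          induction hy using Submodule.span_induction with
          | mem x hx =>
            obtain ⟨a, rfl⟩ := hx
            simp [e, KaehlerDifferential.tensorKaehlerEquivOfFormallyEtale_apply, hD]
          | zero => simp
          | add x y _ _ hx hy => rw [TensorProduct.tmul_add, map_add, hx, hy]; simp
          | smul a x _ hx =>
            rw [TensorProduct.tmul_smul, ← algebraMap_smul Ω a, map_smul, hx]; simp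
      apply LinearMap.ext
      intro x
      obtain ⟨y, rfl⟩ := e.surjective x
      exact LinearMap.congr_fun this y
    ext x
    rw [← D.liftKaehlerDifferential_comp_D, h]; rfl

/-- elements killed by all derivations are constants -/
lemma const_of_deriv {Ω : Type*} [Field Ω] [Algebra ℂ Ω] (x : Ω)
    (hx : ∀ D : Derivation ℂ Ω Ω, D x = 0) : ∃ c : ℂ, x = algebraMap ℂ Ω c := by
  by_contra hcon
  have htr : Transcendental ℂ x := by
    intro halg
    have hIntg : IsIntegral ℂ x := halg.isIntegral
    haveI : Algebra.IsIntegral ℂ (integralClosure ℂ Ω) := inferInstance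
    obtain ⟨y, hy⟩ := (IsAlgClosed.algebraMap_bijective_of_isIntegral (k := ℂ)
      (K := integralClosure ℂ Ω)).2 ⟨x, hIntg⟩
    exact hcon ⟨y, (congrArg Subtype.val hy).symm⟩
  have hs : AlgebraicIndepOn ℂ id ({x} : Set Ω) := by
    have h0 : AlgebraicIndependent ℂ (fun i : ({x} : Set Ω) => (i : Ω)) := by
      rw [algebraicIndependent_unique_type_iff]; exact htr
    exact h0
  obtain ⟨s, hxs, hs⟩ := exists_isTranscendenceBasis_superset hs
  let A := MvPolynomial s ℂ
  letI : Algebra A Ω := (aeval (fun i : s => (i : Ω))).toAlgebra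
  haveI : IsScalarTower ℂ A Ω := IsScalarTower.of_algHom (aeval (fun i : s => (i : Ω)))
  haveI : FaithfulSMul A Ω := (faithfulSMul_iff_algebraMap_injective _ _).2 hs.1
  haveI : Algebra.IsAlgebraic A Ω := by
    have h1 := hs.isAlgebraic
    refine ⟨fun y => ?_⟩
    obtain ⟨q, hq0, hq⟩ := h1.1 y
    let e : A ≃ₐ[ℂ] Algebra.adjoin ℂ (Set.range ((↑) : s → Ω)) := hs.1.aevalEquiv
    refine ⟨q.map e.symm.toRingHom, ?_, ?_⟩
    · rw [Ne, Polynomial.map_eq_zero_iff]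
      · exact hq0
      · exact e.symm.injective
    · rw [Polynomial.aeval_def, Polynomial.eval₂_map, ← hq, Polynomial.aeval_def]
      congr 1
      ext t
      obtain ⟨t, rfl⟩ := e.surjective t
      have : e.symm (e t) = t := e.symm_apply_apply t
      change aeval (fun i : s => (i : Ω)) (e.symm (e t)) = (e t : Ω)
      rw [this]
      exact (hs.1.algebraMap_aevalEquiv t).symm
  let i0 : s := ⟨x, hxs rfl⟩
  let d : Derivation ℂ A Ω := MvPolynomial.mkDerivation ℂ (fun _ : s => (1 : Ω))
  obtain ⟨D, hD⟩ := (deriv_lift (A := A) (Ω := Ω)).1 d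
  have h1 := hD (MvPolynomial.X i0)
  have h2 : algebraMap A Ω (MvPolynomial.X i0) = x := by
    change aeval (fun i : s => (i : Ω)) (MvPolynomial.X i0) = x
    simp [i0]
  rw [h2, hx] at h1
  have h3 : d (MvPolynomial.X i0) = 1 := MvPolynomial.mkDerivation_X ℂ (fun _ : s => (1 : Ω)) i0
  rw [h3] at h1
  exact zero_ne_one h1

end ProjGeo
end

section
namespace ProjGeo

/-- conjugate of a derivation -/
def conjDer {Ω : Type*} [Field Ω] [Algebra ℂ Ω] (σ : Ω ≃ₐ[ℂ] Ω) (D : Derivation ℂ Ω Ω) :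
    Derivation ℂ Ω Ω :=
  Derivation.mk' (σ.toLinearMap ∘ₗ D.toLinearMap ∘ₗ σ.symm.toLinearMap) (by
    intro a b
    simp)

@[simp] lemma conjDer_apply {Ω : Type*} [Field Ω] [Algebra ℂ Ω] (σ : Ω ≃ₐ[ℂ] Ω)
    (D : Derivation ℂ Ω Ω) (x : Ω) : conjDer σ D x = σ (D (σ.symm x)) := rfl

/-- evaluation of derivations at a vector -/
def evDer {Ω : Type*} [Field Ω] [Algebra ℂ Ω] {N : ℕ} (v : Fin N → Ω) :
    Derivation ℂ Ω Ω →ₗ[Ω] (Fin N → Ω) where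
  toFun D := fun i => D (v i)
  map_add' _ _ := by ext; simp
  map_smul' _ _ := by ext; simp

@[simp] lemma evDer_apply {Ω : Type*} [Field Ω] [Algebra ℂ Ω] {N : ℕ} (v : Fin N → Ω)
    (D : Derivation ℂ Ω Ω) (i : Fin N) : evDer v D i = D (v i) := rfl

lemma finrank_range_conj {Ω : Type*} [Field Ω] [Algebra ℂ Ω] {N : ℕ} (v : Fin N → Ω)
    (σ : Ω ≃ₐ[ℂ] Ω) : Module.finrank Ω (LinearMap.range (evDer v)) =
      Module.finrank Ω (LinearMap.range (evDer (fun i => σ (v i)))) := by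
  have key : ∀ (τ : Ω ≃ₐ[ℂ] Ω) (v : Fin N → Ω) (y : Fin N → Ω), y ∈ LinearMap.range (evDer v) →
      (fun i => τ (y i)) ∈ LinearMap.range (evDer (fun i => τ (v i))) := by
    rintro τ v y ⟨D, rfl⟩
    exact ⟨conjDer τ D, by ext i; simp⟩
  let j : LinearMap.range (evDer v) ≃+ LinearMap.range (evDer (fun i => σ (v i))) :=
    { toFun := fun y => ⟨_, key σ v y.1 y.2⟩
      invFun := fun y => ⟨fun i => σ.symm (y.1 i), by
        have := key σ.symm _ y.1 y.2
        simpa using this⟩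
      left_inv := fun y => by ext; simp
      right_inv := fun y => by ext; simp
      map_add' := fun x y => by ext; simp }
  unfold Module.finrank
  rw [rank_eq_of_equiv_equiv (σ : Ω → Ω) j σ.bijective ?_]
  intro r m
  ext i
  simp [j]

/-- abstract trisecant lemma -/
lemma trisecant {Ω : Type*} [Field Ω] [Algebra ℂ Ω] {N : ℕ} (v w : Fin N → Ω)
    (hinj : ∀ D : Derivation ℂ Ω Ω, (∀ i, D (v i) + D (w i) = 0) → D = 0)
    (hsplit : ∀ D : Derivation ℂ Ω Ω, ∃ D1 : Derivation ℂ Ω Ω,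
      (∀ i, D1 (v i) = D (v i)) ∧ ∀ i, D1 (w i) = 0)
    (hEv : ∃ D : Derivation ℂ Ω Ω, ∀ i, D (v i) = v i)
    (hEw : ∃ D : Derivation ℂ Ω Ω, ∀ i, D (w i) = w i)
    (σ : Ω ≃ₐ[ℂ] Ω) (α β : Ω) (hα : α ≠ 0) (hβ : β ≠ 0)
    (hσ : ∀ i, σ (v i) = α * v i + β * w i) (D0 : Derivation ℂ Ω Ω) :
    ∃ c : Ω, ∀ i, D0 (w i) = c * w i := by
  have hinj' : Function.Injective (evDer (fun i => v i + w i)) := by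
    rw [← LinearMap.ker_eq_bot, LinearMap.ker_eq_bot']
    intro D hD
    apply hinj
    intro i
    have := congrFun hD i
    simpa using this
  haveI : Module.Finite Ω (Derivation ℂ Ω Ω) := Module.Finite.of_injective _ hinj'
  -- disjointness of tangent spaces
  have hdisj : ∀ D D' : Derivation ℂ Ω Ω, (∀ i, D (v i) + D' (w i) = 0) → ∀ i, D (v i) = 0 := by
    intro D D' h i
    obtain ⟨D1, h1, h2⟩ := hsplit D
    obtain ⟨D2, h3, h4⟩ := hsplit D'
    have : D1 + (D' - D2) = 0 := by
      apply hinj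
      intro i
      have := h i
      simp [h1, h2, h3, h4, this]
    have := congrArg (fun E : Derivation ℂ Ω Ω => E (v i)) this
    simpa [h1, h3] using this
  obtain ⟨Ev, hEv⟩ := hEv
  obtain ⟨Ew, hEw⟩ := hEw
  set t := β / α with ht
  have ht0 : t ≠ 0 := div_ne_zero hβ hα
  let u : Fin N → Ω := fun i => v i + t * w i
  have hu : ∀ i, σ (v i) = α * u i := fun i => by
    rw [hσ]; simp only [u, ht]; field_simp
  let T := LinearMap.range (evDer (fun i => σ (v i)))
  have huT : u ∈ T := by
    have h1 : (fun i => σ (v i)) ∈ T := ⟨conjDer σ Ev, by ext i; simp [hEv]⟩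
    have h2 : u = α⁻¹ • (fun i => σ (v i)) := by
      ext i; simp [hu, hα]
    rw [h2]; exact T.smul_mem _ h1
  have hDu : ∀ D : Derivation ℂ Ω Ω, evDer u D ∈ T := by
    intro D
    have h2 : evDer u D = α⁻¹ • (evDer (fun i => σ (v i)) D - (D α) • u) := by
      ext i
      simp only [evDer_apply, Pi.smul_apply, Pi.sub_apply, smul_eq_mul, hu, Derivation.leibniz]
      field_simp; ring
    rw [h2]
    exact T.smul_mem _ (T.sub_mem ⟨D, rfl⟩ (T.smul_mem _ huT))
  let E1 := LinearMap.ker (evDer w)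
  have hE1 : ∀ D ∈ E1, ∀ i, D (w i) = 0 := fun D hD i => congrFun (LinearMap.mem_ker.1 hD) i
  have hr1 : Module.finrank Ω E1 = Module.finrank Ω (LinearMap.range (evDer v)) := by
    have h1 : Function.Injective ((evDer v).domRestrict E1) := by
      rw [← LinearMap.ker_eq_bot, LinearMap.ker_eq_bot']
      intro D hD
      apply Subtype.ext
      apply hinj
      intro i
      have h3 := congrFun hD i
      have h4 := hE1 D.1 D.2 i
      simp at h3
      simp [h3, h4]
    have h2 : LinearMap.range ((evDer v).domRestrict E1) = LinearMap.range (evDer v) := by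
      apply le_antisymm
      · rintro _ ⟨D, rfl⟩
        exact ⟨D.1, rfl⟩
      · rintro _ ⟨D, rfl⟩
        obtain ⟨D1, h3, h4⟩ := hsplit D
        exact ⟨⟨D1, LinearMap.mem_ker.2 (by ext i; simp [h4])⟩, by ext i; simp [h3]⟩
    rw [← h2, LinearMap.finrank_range_of_inj h1]
  rw [finrank_range_conj v σ] at hr1
  let g : E1 →ₗ[Ω] T := LinearMap.codRestrict T ((evDer u).domRestrict E1) (fun D => hDu D.1)
  have hval : ∀ (D : Derivation ℂ Ω Ω) i, D (u i) = D (v i) + t * D (w i) + (D t) * w i := by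
    intro D i
    simp only [u, map_add, Derivation.leibniz, smul_eq_mul]; ring
  have hg : Function.Injective g := by
    rw [← LinearMap.ker_eq_bot, LinearMap.ker_eq_bot']
    intro D hD
    apply Subtype.ext
    have h4 := hE1 D.1 D.2
    have h3 : ∀ i, D.1 (u i) = 0 := fun i => congrFun (congrArg Subtype.val hD) i
    have h5 := hdisj D.1 ((D.1 t) • Ew) (fun i => by
      have := h3 i
      rw [hval, h4] at this
      simp only [Derivation.smul_apply, hEw, smul_eq_mul]
      linear_combination this)
    apply hinj
    intro i
    simp [h5, h4]
  have hgs : Function.Surjective g :=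
    (LinearMap.injective_iff_surjective_of_finrank_eq_finrank hr1).1 hg
  obtain ⟨D1, h1, h2⟩ := hsplit D0
  obtain ⟨D, hD⟩ := hgs ⟨evDer u (D0 - D1), hDu _⟩
  have h4 := hE1 D.1 D.2
  have h3 : ∀ i, D.1 (u i) = (D0 - D1) (u i) := fun i => congrFun (congrArg Subtype.val hD) i
  have h6 : ∀ i, D.1 (v i) + (D.1 t * w i - (t * D0 (w i) + (D0 - D1) t * w i)) = 0 := by
    intro i
    have := h3 i
    rw [hval, hval, h4] at this
    simp only [Derivation.sub_apply, h1, h2] at this ⊢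
    linear_combination this
  have h5 := hdisj D.1 ((D.1 t) • Ew - (t • D0 + ((D0 - D1) t) • Ew)) (fun i => by
    have := h6 i
    simpa [hEw] using this)
  have h7 : D.1 = 0 := hinj _ (fun i => by simp [h5, h4])
  refine ⟨-((D0 - D1) t) / t, fun i => ?_⟩
  have := h6 i
  rw [h7] at this
  simp only [Derivation.coe_zero, Pi.zero_apply, zero_mul] at this
  field_simp
  linear_combination -this

end ProjGeo
end

section
open scoped TensorProduct
namespace ProjGeo

section tensor
variable {R : Type} [CommRing R] [IsDomain R] [Algebra ℂ R]

lemma basis_coord_map {ι : Type} (b : Module.Basis ι ℂ R) (θ : R →ₐ[ℂ] ℂ) (x : R ⊗[ℂ] R) :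
    ∀ i, b.repr (Algebra.TensorProduct.lift ((Algebra.ofId ℂ R).comp θ) (AlgHom.id ℂ R)
      (fun _ _ => Commute.all _ _) x) i = θ ((b.baseChange R).repr x i) := by
  intro i
  induction x using TensorProduct.induction_on with
  | zero => simp
  | add x y hx hy => simp only [map_add, Finsupp.add_apply, hx, hy]
  | tmul a c =>
    simp only [Algebra.TensorProduct.lift_tmul, AlgHom.comp_apply, AlgHom.id_apply,
      Algebra.ofId_apply, Module.Basis.baseChange_repr_tmul]
    rw [← Algebra.smul_def]
    simp [mul_comm]

lemma tensor_domain (hsep : ∀ a : R, (∀ θ : R →ₐ[ℂ] ℂ, θ a = 0) → a = 0) :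
    IsDomain (R ⊗[ℂ] R) := by
  let b := Module.Free.chooseBasis ℂ R
  let B := b.baseChange R
  haveI : Nontrivial (R ⊗[ℂ] R) := by
    obtain ⟨i⟩ := b.index_nonempty
    exact ⟨B i, 0, B.ne_zero i⟩
  haveI : NoZeroDivisors (R ⊗[ℂ] R) := by
    refine ⟨fun {x y} hxy => ?_⟩
    by_contra hcon
    push Not at hcon
    have hx : ∃ i, B.repr x i ≠ 0 := by
      by_contra h; push Not at h
      exact hcon.1 (B.repr.map_eq_zero_iff.1 (Finsupp.ext h))
    have hy : ∃ i, B.repr y i ≠ 0 := by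
      by_contra h; push Not at h
      exact hcon.2 (B.repr.map_eq_zero_iff.1 (Finsupp.ext h))
    obtain ⟨i, hi⟩ := hx
    obtain ⟨j, hj⟩ := hy
    refine mul_ne_zero hi hj (hsep _ fun θ => ?_)
    rw [map_mul]
    let ψ := Algebra.TensorProduct.lift ((Algebra.ofId ℂ R).comp θ) (AlgHom.id ℂ R)
      (fun _ _ => Commute.all _ _)
    have h1 : ψ x * ψ y = 0 := by rw [← map_mul, hxy, map_zero]
    rw [← basis_coord_map b θ x i, ← basis_coord_map b θ y j]
    rcases mul_eq_zero.1 h1 with h | h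
    · apply mul_eq_zero.2; left; change b.repr (ψ x) i = 0; rw [h]; simp
    · apply mul_eq_zero.2; right; change b.repr (ψ y) j = 0; rw [h]; simp
  exact IsDomain.mk

lemma tensor_sep (hsep : ∀ a : R, (∀ θ : R →ₐ[ℂ] ℂ, θ a = 0) → a = 0) (x : R ⊗[ℂ] R)
    (hx : ∀ θ₁ θ₂ : R →ₐ[ℂ] ℂ, Algebra.TensorProduct.lift θ₁ θ₂ (fun _ _ => Commute.all _ _) x = 0) :
    x = 0 := by
  let b := Module.Free.chooseBasis ℂ R
  let B := b.baseChange R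
  apply B.repr.map_eq_zero_iff.1
  ext i
  refine hsep _ fun θ => ?_
  rw [← basis_coord_map b θ x i]
  have : Algebra.TensorProduct.lift ((Algebra.ofId ℂ R).comp θ) (AlgHom.id ℂ R)
      (fun _ _ => Commute.all _ _) x = 0 := by
    apply hsep
    intro θ₂
    rw [← hx θ θ₂]
    change (θ₂.comp (Algebra.TensorProduct.lift ((Algebra.ofId ℂ R).comp θ) (AlgHom.id ℂ R)
      (fun _ _ => Commute.all _ _))) x = _
    congr 1
    ext a <;> simp [Algebra.ofId_apply]
  rw [this]; simp

/-- gluing derivations on tensor products -/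
lemma tensor_deriv [IsDomain (R ⊗[ℂ] R)] {Ω : Type} [Field Ω] [Algebra ℂ Ω] [Algebra (R ⊗[ℂ] R) Ω]
    [IsScalarTower ℂ (R ⊗[ℂ] R) Ω] [FaithfulSMul (R ⊗[ℂ] R) Ω] [Algebra.IsAlgebraic (R ⊗[ℂ] R) Ω]
    (δ₁ δ₂ : R →ₗ[ℂ] Ω)
    (h₁ : ∀ a b, δ₁ (a * b) = algebraMap (R ⊗[ℂ] R) Ω (a ⊗ₜ 1) * δ₁ b +
      algebraMap (R ⊗[ℂ] R) Ω (b ⊗ₜ 1) * δ₁ a)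
    (h₂ : ∀ a b, δ₂ (a * b) = algebraMap (R ⊗[ℂ] R) Ω (1 ⊗ₜ a) * δ₂ b +
      algebraMap (R ⊗[ℂ] R) Ω (1 ⊗ₜ b) * δ₂ a) :
    ∃ D : Derivation ℂ Ω Ω, (∀ a, D (algebraMap (R ⊗[ℂ] R) Ω (a ⊗ₜ 1)) = δ₁ a) ∧
      ∀ b, D (algebraMap (R ⊗[ℂ] R) Ω (1 ⊗ₜ b)) = δ₂ b := by
  let ι : R ⊗[ℂ] R →ₐ[ℂ] Ω := IsScalarTower.toAlgHom ℂ (R ⊗[ℂ] R) Ω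
  let ι₁ : R →ₐ[ℂ] Ω := ι.comp Algebra.TensorProduct.includeLeft
  let ι₂ : R →ₐ[ℂ] Ω := ι.comp Algebra.TensorProduct.includeRight
  have hι : ∀ a b : R, algebraMap (R ⊗[ℂ] R) Ω (a ⊗ₜ b) = ι₁ a * ι₂ b := by
    intro a b
    change ι _ = ι (a ⊗ₜ 1) * ι (1 ⊗ₜ b)
    rw [← map_mul]; simp
  have h11 : ∀ a b, δ₁ (a * b) = ι₁ a * δ₁ b + ι₁ b * δ₁ a := h₁
  have h22 : ∀ a b, δ₂ (a * b) = ι₂ a * δ₂ b + ι₂ b * δ₂ a := h₂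
  have h10 : δ₁ 1 = 0 := by
    have := h11 1 1
    simpa using this
  have h20 : δ₂ 1 = 0 := by
    have := h22 1 1
    simpa using this
  let L : R ⊗[ℂ] R →ₗ[ℂ] Ω := TensorProduct.lift
    ((LinearMap.mul ℂ Ω).compl₁₂ δ₁ ι₂.toLinearMap + (LinearMap.mul ℂ Ω).compl₁₂ ι₁.toLinearMap δ₂)
  have hL : ∀ a b, L (a ⊗ₜ b) = δ₁ a * ι₂ b + ι₁ a * δ₂ b := by intro a b; simp [L]
  let d : Derivation ℂ (R ⊗[ℂ] R) Ω := Derivation.mk' L (by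
    intro x y
    induction x using TensorProduct.induction_on with
    | zero => simp
    | add x x' hx hx' => rw [add_mul, map_add, hx, hx', map_add, smul_add, add_smul]; abel
    | tmul a b =>
      induction y using TensorProduct.induction_on with
      | zero => simp
      | add x x' hx hx' => rw [mul_add, map_add, hx, hx', map_add, smul_add, add_smul]; abel
      | tmul a' b' =>
        rw [Algebra.TensorProduct.tmul_mul_tmul, hL, hL, hL, Algebra.smul_def, Algebra.smul_def,
          hι, hι, h11, h22, map_mul, map_mul]
        ring)
  obtain ⟨D, hD⟩ := (deriv_lift (A := R ⊗[ℂ] R) (Ω := Ω)).1 d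
  refine ⟨D, fun a => ?_, fun a => ?_⟩
  · rw [hD]
    change L _ = _
    simp [hL, h20]
  · rw [hD]
    change L _ = _
    simp [hL, h10]

end tensor

end ProjGeo
end

section
open scoped TensorProduct
namespace ProjGeo

/-- A generic pair of points of the cone, in an algebraically closed field. -/
structure GenericPair {r : ℕ} (X : Set (Pt r)) (Ω : Type) [Field Ω] [Algebra ℂ Ω]
    (v w : Fin (r + 1) → Ω) : Prop where
  ptv : PtOver X v
  ptw : PtOver X w
  gen : ∀ F : MvPolynomial (Fin (r + 1) ⊕ Fin (r + 1)) ℂ, aeval (Sum.elim v w) F = 0 ↔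
    ∀ v0 ∈ Cone X, ∀ w0 ∈ Cone X, eval (Sum.elim v0 w0) F = 0
  split : ∀ D : Derivation ℂ Ω Ω, ∃ D1 : Derivation ℂ Ω Ω,
      (∀ i, D1 (v i) = D (v i)) ∧ ∀ i, D1 (w i) = 0
  eulv : ∃ D : Derivation ℂ Ω Ω, ∀ i, D (v i) = v i
  eulw : ∃ D : Derivation ℂ Ω Ω, ∀ i, D (w i) = w i
  alg : Algebra.IsAlgebraic (Algebra.adjoin ℂ (Set.range v ∪ Set.range w)) Ω

lemma aeval_mem_adjoin_aux {K Ω : Type*} [CommRing K] [CommRing Ω] [Algebra K Ω] {S : Subalgebra K Ω} {N : Type*}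
    (v : N → Ω) (hv : ∀ i, v i ∈ S) (g : MvPolynomial N K) : aeval v g ∈ S := by
  have := MvPolynomial.comp_aeval_apply (fun i => (⟨v i, hv i⟩ : S)) S.val g
  change _ = aeval v g at this
  rw [← this]
  exact (aeval (fun i => (⟨v i, hv i⟩ : S)) g).2

/-- Euler derivation on the cone ring -/
lemma exists_euler {r : ℕ} (X : Set (Pt r)) :
    ∃ E : (MvPolynomial (Fin (r + 1)) ℂ ⧸ II X) →ₗ[ℂ] (MvPolynomial (Fin (r + 1)) ℂ ⧸ II X),
      (∀ i, E (Ideal.Quotient.mk _ (MvPolynomial.X i)) = Ideal.Quotient.mk _ (MvPolynomial.X i)) ∧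
      ∀ a b, E (a * b) = a * E b + b * E a := by
  let R := MvPolynomial (Fin (r + 1)) ℂ ⧸ II X
  let e : Derivation ℂ (MvPolynomial (Fin (r + 1)) ℂ) (MvPolynomial (Fin (r + 1)) ℂ) :=
    ∑ i, (MvPolynomial.X i : MvPolynomial (Fin (r + 1)) ℂ) • pderiv i
  have he : ∀ g, e g = ∑ i, MvPolynomial.X i * pderiv i g := by
    intro g
    change (Derivation.coeFnAddMonoidHom e) g = _
    simp only [e, map_sum, Finset.sum_apply]
    rfl
  let d : Derivation ℂ (MvPolynomial (Fin (r + 1)) ℂ) R := (Submodule.mkQ (II X)).compDer e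
  have hd : ∀ g, d g = Ideal.Quotient.mk (II X) (∑ i, MvPolynomial.X i * pderiv i g) := by
    intro g
    rw [← he]; rfl
  have hker : ∀ g ∈ II X, d g = 0 := by
    intro g hg
    refine Submodule.span_induction (p := fun g _ => d g = 0) ?_ ?_ ?_ ?_ hg
    · rintro g ⟨⟨n, hn⟩, hX⟩
      rw [hd, hn.sum_X_mul_pderiv, map_nsmul,
        Ideal.Quotient.eq_zero_iff_mem.2 (show g ∈ II X from Ideal.subset_span ⟨⟨n, hn⟩, hX⟩), smul_zero]
    · simp
    · intro x y _ _ hx hy; rw [map_add, hx, hy, add_zero]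
    · intro a x hx' hx
      rw [smul_eq_mul, Derivation.leibniz, hx, smul_zero, zero_add]
      have : (Ideal.Quotient.mk (II X) x : R) = 0 := Ideal.Quotient.eq_zero_iff_mem.2 hx'
      rw [hd]
      exact (map_mul (Ideal.Quotient.mk (II X)) x _).trans (by rw [this, zero_mul])
  let E : R →ₗ[ℂ] R := Submodule.liftQ ((II X).restrictScalars ℂ) d.toLinearMap hker
  have hE : ∀ g, E (Ideal.Quotient.mk _ g) = d g := fun g => rfl
  refine ⟨E, fun i => ?_, fun a b => ?_⟩
  · rw [hE, hd]
    congr 1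
    rw [Finset.sum_eq_single i]
    · simp
    · intro j _ hj; rw [pderiv_X_of_ne hj.symm, mul_zero]
    · simp
  · obtain ⟨a, rfl⟩ := Ideal.Quotient.mk_surjective a
    obtain ⟨b, rfl⟩ := Ideal.Quotient.mk_surjective b
    rw [← map_mul, hE, hE, hE, Derivation.leibniz]; rfl

lemma exists_closure (A : Type) [CommRing A] [IsDomain A] [Algebra ℂ A] :
    ∃ (Ω : Type) (_ : Field Ω) (_ : Algebra ℂ Ω) (_ : IsAlgClosed Ω) (_ : Algebra A Ω),
      IsScalarTower ℂ A Ω ∧ FaithfulSMul A Ω ∧ Algebra.IsAlgebraic A Ω := by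
  refine ⟨AlgebraicClosure (FractionRing A), inferInstance, inferInstance, inferInstance,
    inferInstance, inferInstance, ?_, ?_⟩
  · rw [faithfulSMul_iff_algebraMap_injective,
      IsScalarTower.algebraMap_eq A (FractionRing A) (AlgebraicClosure (FractionRing A))]
    exact (algebraMap (FractionRing A) _).injective.comp (IsFractionRing.injective A _)
  · rw [IsFractionRing.comap_isAlgebraic_iff (K := FractionRing A)]
    infer_instance

lemma exists_genericPair_aux {r : ℕ} {X : Set (Pt r)} (hX : IsIrrVar X)
    (R : Type) [CommRing R] [IsDomain R] [Algebra ℂ R] (x : Fin (r + 1) → R)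
    (hsurj : ∀ a : R, ∃ g : MvPolynomial (Fin (r + 1)) ℂ, aeval x g = a)
    (hker : ∀ g : MvPolynomial (Fin (r + 1)) ℂ, aeval x g = 0 ↔ g ∈ II X)
    (hpt : ∀ v0 ∈ Cone X, ∃ θ : R →ₐ[ℂ] ℂ, ∀ i, θ (x i) = v0 i)
    (E : R →ₗ[ℂ] R) (hE1 : ∀ i, E (x i) = x i) (hE2 : ∀ a b, E (a * b) = a * E b + b * E a) :
    ∃ (Ω : Type) (_ : Field Ω) (_ : Algebra ℂ Ω) (_ : IsAlgClosed Ω) (v w : Fin (r + 1) → Ω),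
      GenericPair X Ω v w := by
  have hsep : ∀ a : R, (∀ θ : R →ₐ[ℂ] ℂ, θ a = 0) → a = 0 := by
    intro a ha
    obtain ⟨g, rfl⟩ := hsurj a
    rw [hker, mem_II_iff hX.1]
    intro v0 hv0
    obtain ⟨θ, hθ⟩ := hpt v0 hv0
    have := ha θ
    rw [MvPolynomial.comp_aeval_apply] at this
    rw [← MvPolynomial.coe_aeval_eq_eval]
    simpa [hθ] using this
  have hpt' : ∀ θ : R →ₐ[ℂ] ℂ, (fun i => θ (x i)) ∈ Cone X := by
    intro θ
    apply mem_Cone_of_II hX.2.1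
    intro g hg
    rw [← MvPolynomial.coe_aeval_eq_eval]
    change aeval _ g = 0
    rw [← MvPolynomial.comp_aeval_apply, (hker g).2 hg, map_zero]
  haveI := tensor_domain hsep
  obtain ⟨Ω, _, _, _, _, _, _, _⟩ := exists_closure (R ⊗[ℂ] R)
  let ι : R ⊗[ℂ] R →ₐ[ℂ] Ω := IsScalarTower.toAlgHom ℂ (R ⊗[ℂ] R) Ω
  have hιinj : Function.Injective ι := FaithfulSMul.algebraMap_injective (R ⊗[ℂ] R) Ω
  let ι₁ : R →ₐ[ℂ] Ω := ι.comp Algebra.TensorProduct.includeLeft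
  let ι₂ : R →ₐ[ℂ] Ω := ι.comp Algebra.TensorProduct.includeRight
  refine ⟨Ω, inferInstance, inferInstance, inferInstance, fun i => ι₁ (x i), fun i => ι₂ (x i), ?_⟩
  refine ⟨?_, ?_, ?_, ?_, ?_, ?_, ?_⟩
  · intro g hg
    rw [← MvPolynomial.comp_aeval_apply, (hker g).2 hg, map_zero]
  · intro g hg
    rw [← MvPolynomial.comp_aeval_apply, (hker g).2 hg, map_zero]
  · intro F
    let y : Fin (r + 1) ⊕ Fin (r + 1) → R ⊗[ℂ] R := Sum.elim (fun i => x i ⊗ₜ 1) (fun i => 1 ⊗ₜ x i)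
    have h1 : (Sum.elim (fun i => ι₁ (x i)) (fun i => ι₂ (x i))) = fun i => ι (y i) := by
      ext i; cases i <;> rfl
    rw [h1, ← MvPolynomial.comp_aeval_apply, map_eq_zero_iff _ hιinj]
    have h2 : ∀ θ₁ θ₂ : R →ₐ[ℂ] ℂ, Algebra.TensorProduct.lift θ₁ θ₂ (fun _ _ => Commute.all _ _)
        (aeval y F) = eval (Sum.elim (fun i => θ₁ (x i)) (fun i => θ₂ (x i))) F := by
      intro θ₁ θ₂
      rw [MvPolynomial.comp_aeval_apply, ← MvPolynomial.coe_aeval_eq_eval]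
      change _ = aeval _ F
      congr 2
      ext i; cases i <;> simp [y]
    constructor
    · intro h v0 hv0 w0 hw0
      obtain ⟨θ₁, h3⟩ := hpt v0 hv0
      obtain ⟨θ₂, h4⟩ := hpt w0 hw0
      have := h2 θ₁ θ₂
      rw [h, map_zero] at this
      simp only [h3, h4] at this
      exact this.symm
    · intro h
      apply tensor_sep hsep
      intro θ₁ θ₂
      rw [h2]
      exact h _ (hpt' θ₁) _ (hpt' θ₂)
  · intro D
    obtain ⟨D1, h1, h2⟩ := tensor_deriv (R := R) (Ω := Ω) (D.toLinearMap ∘ₗ ι₁.toLinearMap) 0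
      (by
        intro a b
        change D (ι₁ (a * b)) = ι₁ a * D (ι₁ b) + ι₁ b * D (ι₁ a)
        rw [map_mul, Derivation.leibniz]; rfl) (by simp)
    exact ⟨D1, fun i => h1 _, fun i => h2 _⟩
  · obtain ⟨D1, h1, h2⟩ := tensor_deriv (R := R) (Ω := Ω) (ι₁.toLinearMap ∘ₗ E) 0
      (by
        intro a b
        change ι₁ (E (a * b)) = ι₁ a * ι₁ (E b) + ι₁ b * ι₁ (E a)
        rw [hE2, map_add, map_mul, map_mul]) (by simp)
    refine ⟨D1, fun i => (h1 _).trans ?_⟩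
    change ι₁ (E (x i)) = ι₁ (x i)
    rw [hE1]
  · obtain ⟨D1, h1, h2⟩ := tensor_deriv (R := R) (Ω := Ω) 0 (ι₂.toLinearMap ∘ₗ E) (by simp)
      (by
        intro a b
        change ι₂ (E (a * b)) = ι₂ a * ι₂ (E b) + ι₂ b * ι₂ (E a)
        rw [hE2, map_add, map_mul, map_mul])
    refine ⟨D1, fun i => (h2 _).trans ?_⟩
    change ι₂ (E (x i)) = ι₂ (x i)
    rw [hE1]
  · let S := Algebra.adjoin ℂ ((Set.range fun i => ι₁ (x i)) ∪ Set.range fun i => ι₂ (x i))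
    have hmem1 : ∀ a : R, ι₁ a ∈ S := by
      intro a
      obtain ⟨g, rfl⟩ := hsurj a
      rw [MvPolynomial.comp_aeval_apply]
      have := aeval_mem_adjoin_aux (S := S) (fun i => ι₁ (x i))
        (fun i => Algebra.subset_adjoin (Or.inl ⟨i, rfl⟩)) g
      exact this
    have hmem2 : ∀ a : R, ι₂ a ∈ S := by
      intro a
      obtain ⟨g, rfl⟩ := hsurj a
      rw [MvPolynomial.comp_aeval_apply]
      have := aeval_mem_adjoin_aux (S := S) (fun i => ι₂ (x i))
        (fun i => Algebra.subset_adjoin (Or.inr ⟨i, rfl⟩)) g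
      exact this
    have hmem : ∀ a : R ⊗[ℂ] R, ι a ∈ S := by
      intro a
      induction a using TensorProduct.induction_on with
      | zero => rw [map_zero]; exact S.zero_mem
      | add a b ha hb => rw [map_add]; exact S.add_mem ha hb
      | tmul a b =>
        have : ι (a ⊗ₜ b) = ι₁ a * ι₂ b := by
          change ι _ = ι (a ⊗ₜ 1) * ι (1 ⊗ₜ b)
          rw [← map_mul]; simp
        rw [this]; exact S.mul_mem (hmem1 a) (hmem2 b)
    let j : R ⊗[ℂ] R →ₐ[ℂ] S := ι.codRestrict S hmem
    letI : Algebra (R ⊗[ℂ] R) S := j.toAlgebra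
    haveI : IsScalarTower (R ⊗[ℂ] R) S Ω := IsScalarTower.of_algebraMap_eq (fun _ => rfl)
    exact Algebra.IsAlgebraic.extendScalars (R := R ⊗[ℂ] R) (S := S) (A := Ω) (by
      intro a b hab
      exact hιinj (congrArg Subtype.val hab))

lemma exists_genericPair {r : ℕ} {X : Set (Pt r)} (hX : IsIrrVar X) :
    ∃ (Ω : Type) (_ : Field Ω) (_ : Algebra ℂ Ω) (_ : IsAlgClosed Ω) (v w : Fin (r + 1) → Ω),
      GenericPair X Ω v w := by
  haveI := II_isPrime hX
  let R := MvPolynomial (Fin (r + 1)) ℂ ⧸ II X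
  let x : Fin (r + 1) → R := fun i => Ideal.Quotient.mk (II X) (MvPolynomial.X i)
  have hmk : ∀ g : MvPolynomial (Fin (r + 1)) ℂ, (Ideal.Quotient.mk (II X) g : R) = aeval x g := by
    intro g
    have : Ideal.Quotient.mkₐ ℂ (II X) = aeval x := by ext i; simp [x]
    exact DFunLike.congr_fun this g
  obtain ⟨E, hE1, hE2⟩ := exists_euler X
  refine exists_genericPair_aux hX R x ?_ ?_ ?_ E hE1 hE2
  · intro a
    obtain ⟨g, rfl⟩ := Ideal.Quotient.mk_surjective a
    exact ⟨g, (hmk g).symm⟩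
  · intro g
    rw [← hmk, Ideal.Quotient.eq_zero_iff_mem]
  · intro v0 hv0
    have hz : ∀ g ∈ II X, aeval v0 g = 0 := fun g hg => (mem_II_iff hX.1 g).1 hg v0 hv0
    refine ⟨Ideal.Quotient.liftₐ (II X) (aeval v0) hz, fun i => ?_⟩
    change aeval v0 (MvPolynomial.X i : MvPolynomial (Fin (r + 1)) ℂ) = _
    simp

end ProjGeo
end

section
namespace ProjGeo

lemma aeval_smul_of_homog {Ω : Type*} [CommRing Ω] [Algebra ℂ Ω] {r : ℕ}
    {p : MvPolynomial (Fin (r + 1)) ℂ} {d : ℕ} (hp : p.IsHomogeneous d)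
    (c : Ω) (v : Fin (r + 1) → Ω) : aeval (c • v) p = c ^ d * aeval v p := by
  rw [aeval_def, aeval_def, eval₂_eq', eval₂_eq', Finset.mul_sum]
  refine Finset.sum_congr rfl fun m hm => ?_
  have hd : ∑ i, m i = d := by
    have := hp (mem_support_iff.1 hm)
    rw [← this, Finsupp.weight_apply, Finsupp.sum_fintype _ _ (by simp)]
    simp
  simp only [Pi.smul_apply, smul_eq_mul, mul_pow, Finset.prod_mul_distrib,
    Finset.prod_pow_eq_pow_sum, hd]
  ring

lemma PtOver.smul {r : ℕ} {X : Set (Pt r)} {Ω : Type*} [CommRing Ω] [Algebra ℂ Ω]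
    {v : Fin (r + 1) → Ω} (hv : PtOver X v) (c : Ω) : PtOver X (c • v) := by
  intro g hg
  refine Submodule.span_induction (p := fun g _ => aeval (c • v) g = 0) ?_ ?_ ?_ ?_ hg
  · rintro g ⟨⟨n, hn⟩, hX⟩
    rw [aeval_smul_of_homog hn, hv g (Ideal.subset_span ⟨⟨n, hn⟩, hX⟩), mul_zero]
  · simp
  · intro x y _ _ hx hy; rw [map_add, hx, hy, add_zero]
  · intro a x _ hx; rw [smul_eq_mul, map_mul, hx, mul_zero]

lemma PtOver.map {r : ℕ} {X : Set (Pt r)} {Ω Ω' : Type*} [CommRing Ω] [Algebra ℂ Ω] [CommRing Ω']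
    [Algebra ℂ Ω'] {v : Fin (r + 1) → Ω} (hv : PtOver X v) (σ : Ω →ₐ[ℂ] Ω') :
    PtOver X (fun i => σ (v i)) := by
  intro g hg
  rw [← MvPolynomial.comp_aeval_apply, hv g hg, map_zero]

/-- All that we need about an OADP variety -/
structure Setup {r : ℕ} (X : Set (Pt r)) (h : MvPolynomial (Fin (r + 1)) ℂ) : Prop where
  irr : IsIrrVar X
  nondeg : Nondeg X
  hr : 1 ≤ r
  uniq : UniqueSec X h
  h0 : h ≠ 0
  dense : ∀ p, eval p h ≠ 0 → ∃ v ∈ Cone X, ∃ w ∈ Cone X, v + w = p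
  bot : II X ≠ ⊥

section
variable {r : ℕ} {X : Set (Pt r)} {h : MvPolynomial (Fin (r + 1)) ℂ}
  {Ω : Type} [Field Ω] [Algebra ℂ Ω] {v w : Fin (r + 1) → Ω}

lemma gp_indep (hs : Setup X h) (gp : GenericPair X Ω v w) {P : MvPolynomial (Fin (r + 1)) ℂ} (hP : aeval (v + w) P = 0) : P = 0 := by
  have h1 : ∀ v0 ∈ Cone X, ∀ w0 ∈ Cone X, eval (v0 + w0) P = 0 := by
    let Q : MvPolynomial (Fin (r + 1) ⊕ Fin (r + 1)) ℂ :=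
      aeval (fun i => MvPolynomial.X (Sum.inl i) + MvPolynomial.X (Sum.inr i)) P
    have hQ : aeval (Sum.elim v w) Q = 0 := by
      rw [MvPolynomial.comp_aeval_apply, ← hP]
      congr 2
      ext i; simp
    intro v0 hv0 w0 hw0
    rw [← (gp.gen Q).1 hQ v0 hv0 w0 hw0, ← MvPolynomial.coe_aeval_eq_eval,
      ← MvPolynomial.coe_aeval_eq_eval]
    change _ = aeval _ Q
    rw [MvPolynomial.comp_aeval_apply]
    change aeval _ P = aeval _ P
    congr 2
    ext i; simp
  have h2 : P * h = 0 := by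
    apply MvPolynomial.funext
    intro p
    rw [map_mul, map_zero]
    by_cases hp : eval p h = 0
    · rw [hp, mul_zero]
    · obtain ⟨v0, hv0, w0, hw0, rfl⟩ := hs.dense p hp
      rw [h1 v0 hv0 w0 hw0, zero_mul]
  exact (mul_eq_zero.1 h2).resolve_right hs.h0

lemma gp_not_pt (hs : Setup X h) (gp : GenericPair X Ω v w) : ∃ g ∈ homIdeal X, aeval (v + w) g ≠ 0 := by
  by_contra hcon
  push Not at hcon
  apply hs.bot
  rw [Ideal.span_eq_bot]
  intro g hg
  exact gp_indep hs gp (hcon g hg)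

lemma gp_linIndep (hs : Setup X h) (gp : GenericPair X Ω v w) {a b : Fin (r + 1) → Ω} (ha : PtOver X a) (hb : PtOver X b)
    (hab : v + w = a + b) : LinearIndependent Ω ![a, b] := by
  obtain ⟨g, hg, hgp⟩ := gp_not_pt hs gp
  have hno : ¬ PtOver X (v + w) := fun hp => hgp (hp g (Ideal.subset_span hg))
  rw [LinearIndependent.pair_iff]
  intro s t hst
  by_contra hcon
  apply hno
  rw [hab]
  by_cases hs0 : s = 0
  · have ht0 : t ≠ 0 := fun ht0 => hcon ⟨hs0, ht0⟩
    have : a + b = (1 : Ω) • a := by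
      have h1 : b = 0 := by
        rw [hs0, zero_smul, zero_add] at hst
        exact (smul_eq_zero.1 hst).resolve_left ht0
      rw [h1]; simp
    rw [this]; exact ha.smul _
  · have : a + b = (1 - s⁻¹ * t) • b := by
      have h1 : a = -(s⁻¹ * t) • b := by
        have h2 : s • a = - (t • b) := eq_neg_of_add_eq_zero_left hst
        rw [← inv_smul_smul₀ hs0 a, h2, smul_neg, smul_smul, neg_smul]
      rw [h1, sub_smul, one_smul, neg_smul]; abel
    rw [this]; exact hb.smul _

end

lemma nullst_aux {k : Type*} (L : Type*) (Ω : Type*) [Field k] [Field L] [Field Ω] [IsAlgClosed Ω]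
    [Algebra k Ω] [Algebra k L] [Algebra.FiniteType k L] :
    ∃ e : L →ₐ[k] Ω, ∀ b, IsAlgebraic k (e b) := by
  haveI : Module.Finite k L := finite_of_finite_type_of_isJacobsonRing _ _
  let e : L →ₐ[k] Ω := IsAlgClosed.lift
  exact ⟨e, fun b => (Algebra.IsAlgebraic.isAlgebraic (R := k) b).algHom e⟩

lemma nullst {k Ω : Type*} [Field k] [Field Ω] [IsAlgClosed Ω] [Algebra k Ω] (T : Set Ω)
    (hT : T.Finite) : ∃ φ : Algebra.adjoin k T →ₐ[k] Ω, ∀ b, IsAlgebraic k (φ b) := by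
  haveI : Algebra.FiniteType k (Algebra.adjoin k T) :=
    (Subalgebra.fg_iff_finiteType _).1 ⟨hT.toFinset, by simp⟩
  obtain ⟨m, hm⟩ := Ideal.exists_maximal (Algebra.adjoin k T)
  letI : Field ((Algebra.adjoin k T) ⧸ m) := Ideal.Quotient.field m
  haveI : Algebra.FiniteType k ((Algebra.adjoin k T) ⧸ m) :=
    Algebra.FiniteType.of_surjective (Ideal.Quotient.mkₐ k m)
      Ideal.Quotient.mk_surjective
  obtain ⟨e, he⟩ := nullst_aux (k := k) ((Algebra.adjoin k T) ⧸ m) Ω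
  exact ⟨e.comp (Ideal.Quotient.mkₐ k m), fun b => he _⟩

/-- The elementary computation with binary forms. -/
lemma binary_alg {Ω : Type*} [Field Ω] (K : Subfield Ω) (a b : Ω)
    (hroot : ∀ s t : Ω, ((s = a ∧ t = b) ∨ (s = 1 - a ∧ t = 1 - b)) → t ≠ 0 →
      s / t ∈ K ∧ s / t ≠ 1) : a ∈ K ∧ b ∈ K := by
  have h1 := hroot a b (Or.inl ⟨rfl, rfl⟩)
  have h2 := hroot (1 - a) (1 - b) (Or.inr ⟨rfl, rfl⟩)
  by_cases hb : b = 0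
  · subst hb
    obtain ⟨h3, -⟩ := h2 (by simp)
    refine ⟨?_, K.zero_mem⟩
    have : a = 1 - (1 - a) / (1 - 0) := by simp
    rw [this]; exact K.sub_mem K.one_mem h3
  by_cases hb1 : b = 1
  · subst hb1
    obtain ⟨h3, -⟩ := h1 (by simp)
    exact ⟨by simpa using h3, K.one_mem⟩
  have hb2 : 1 - b ≠ 0 := fun h => hb1 (by linear_combination -h)
  obtain ⟨h3, h4⟩ := h1 hb
  obtain ⟨h5, h6⟩ := h2 hb2
  set ρ := a / b
  set ρ' := (1 - a) / (1 - b)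
  have e1 : a = ρ * b := by simp only [ρ]; field_simp
  have e2 : 1 - a = ρ' * (1 - b) := by simp only [ρ']; field_simp
  have e3 : (ρ' - ρ) * b = ρ' - 1 := by linear_combination e1 + e2
  have hne : ρ' - ρ ≠ 0 := by
    intro h0
    rw [h0, zero_mul] at e3
    exact h6 (by linear_combination -e3)
  have e4 : b = (ρ' - 1) / (ρ' - ρ) := by field_simp; linear_combination e3
  have hbK : b ∈ K := by
    rw [e4]; exact K.div_mem (K.sub_mem h5 K.one_mem) (K.sub_mem h5 h3)
  exact ⟨by rw [e1]; exact K.mul_mem h3 hbK, hbK⟩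

end ProjGeo
end

section
namespace ProjGeo

variable {r : ℕ} {X : Set (Pt r)} {h : MvPolynomial (Fin (r + 1)) ℂ}
  {Ω : Type} [Field Ω] [Algebra ℂ Ω] {v w : Fin (r + 1) → Ω}

/-- roots of a polynomial over the line -/
lemma root_alg {K : IntermediateField ℂ Ω} (hK : ∀ x : Ω, IsAlgebraic K x → x ∈ K)
    {v1 w1 : Fin (r + 1) → Ω} (hv : ∀ i, v1 i ∈ K) (hw : ∀ i, w1 i ∈ K)
    {g : MvPolynomial (Fin (r + 1)) ℂ} (hg : aeval (v1 + w1) g ≠ 0) (ρ : Ω)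
    (hρ : aeval (ρ • v1 + w1) g = 0) : ρ ∈ K := by
  let y : Fin (r + 1) → Polynomial K := fun i =>
    Polynomial.C ⟨v1 i, hv i⟩ * Polynomial.X + Polynomial.C ⟨w1 i, hw i⟩
  let G : Polynomial K := aeval y g
  have hG : ∀ ρ : Ω, Polynomial.aeval ρ G = aeval (ρ • v1 + w1) g := by
    intro ρ
    have := MvPolynomial.comp_aeval_apply y ((Polynomial.aeval (R := K) ρ).restrictScalars ℂ) g
    refine this.trans ?_
    congr 2
    ext i
    change Polynomial.aeval ρ (Polynomial.C ⟨v1 i, hv i⟩ * Polynomial.X +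
      Polynomial.C (⟨w1 i, hw i⟩ : K)) = ρ * v1 i + w1 i
    rw [map_add, map_mul, Polynomial.aeval_X, Polynomial.aeval_C, Polynomial.aeval_C]
    exact congrArg (· + w1 i) (mul_comm _ _)
  apply hK
  refine ⟨G, ?_, ?_⟩
  · intro h0
    apply hg
    have := hG 1
    rw [h0, one_smul] at this
    rw [← this, map_zero]
  · rw [hG, hρ]

lemma gp_algebraic (hs : Setup X h) (gp : GenericPair X Ω v w) [IsAlgClosed Ω]
    (k : IntermediateField ℂ Ω) (hk : ∀ i, v i + w i ∈ k) : Algebra.IsAlgebraic k Ω := by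
  let T : Set Ω := Set.range v ∪ Set.range w
  have hT : T.Finite := (Set.finite_range v).union (Set.finite_range w)
  obtain ⟨φ, hφ⟩ := nullst (k := k) T hT
  let vB : Fin (r + 1) → Algebra.adjoin k T := fun i =>
    ⟨v i, Algebra.subset_adjoin (Or.inl ⟨i, rfl⟩)⟩
  let wB : Fin (r + 1) → Algebra.adjoin k T := fun i =>
    ⟨w i, Algebra.subset_adjoin (Or.inr ⟨i, rfl⟩)⟩
  have hptB : ∀ u : Fin (r + 1) → Algebra.adjoin k T, PtOver X (fun i => (u i : Ω)) →
      PtOver X u := by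
    intro u hu g hg
    have := MvPolynomial.comp_aeval_apply u ((Algebra.adjoin k T).val.restrictScalars ℂ) g
    apply Subtype.ext
    refine this.trans (hu g hg)
  let v1 : Fin (r + 1) → Ω := fun i => φ (vB i)
  let w1 : Fin (r + 1) → Ω := fun i => φ (wB i)
  have hv1 : PtOver X v1 := (hptB vB gp.ptv).map (φ.restrictScalars ℂ)
  have hw1 : PtOver X w1 := (hptB wB gp.ptw).map (φ.restrictScalars ℂ)
  have hsum : v + w = v1 + w1 := by
    ext i
    have h1 : vB i + wB i = algebraMap k (Algebra.adjoin k T) ⟨v i + w i, hk i⟩ := Subtype.ext rfl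
    change _ = φ (vB i) + φ (wB i)
    rw [← map_add, h1, AlgHom.commutes]
    rfl
  have hhp : aeval (v1 + w1) h ≠ 0 := by
    rw [← hsum]
    exact fun h0 => hs.h0 (gp_indep hs gp h0)
  obtain ⟨a, b, hab⟩ := hs.uniq.generic hs.irr.2.1 hv1 hw1 gp.ptv gp.ptw hsum.symm hhp
    (gp_linIndep hs gp hv1 hw1 hsum) (gp_linIndep hs gp gp.ptv gp.ptw rfl)
  have hab' : w = (1 - a) • v1 + (1 - b) • w1 := by
    have : w = v1 + w1 - v := by rw [← hsum]; abel
    rw [this, hab]; module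
  obtain ⟨g, ⟨⟨d, hd⟩, hgX⟩, hgp⟩ := gp_not_pt hs gp
  have hgI : g ∈ II X := Ideal.subset_span ⟨⟨d, hd⟩, hgX⟩
  let K := (algebraicClosure k Ω).restrictScalars ℂ
  have hKmem : ∀ x : Ω, x ∈ K ↔ IsAlgebraic k x := fun x => mem_algebraicClosure_iff
  have hK : ∀ x : Ω, IsAlgebraic K x → x ∈ K := by
    intro x hx
    rw [hKmem]
    have hx' : IsAlgebraic (algebraicClosure k Ω) x := hx
    exact hx'.restrictScalars k
  have hv1K : ∀ i, v1 i ∈ K := fun i => (hKmem _).2 (hφ _)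
  have hw1K : ∀ i, w1 i ∈ K := fun i => (hKmem _).2 (hφ _)
  obtain ⟨haK, hbK⟩ := binary_alg K.toSubfield a b (by
    intro s t hst ht
    have hpt : PtOver X (s • v1 + t • w1) := by
      rcases hst with ⟨rfl, rfl⟩ | ⟨rfl, rfl⟩
      · rw [← hab]; exact gp.ptv
      · rw [← hab']; exact gp.ptw
    have h2 : aeval ((s / t) • v1 + w1) g = 0 := by
      have h3 := hpt.smul t⁻¹ g hgI
      rw [← h3]
      congr 2
      rw [smul_add, smul_smul, smul_smul, inv_mul_cancel₀ ht, one_smul, div_eq_inv_mul]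
    refine ⟨?_, ?_⟩
    · exact root_alg hK hv1K hw1K (g := g) (by rw [← hsum]; exact hgp) _ h2
    · intro h1
      rw [h1, one_smul, ← hsum] at h2
      exact hgp h2)
  have hvK : ∀ i, v i ∈ K := by
    intro i; rw [hab]
    exact K.add_mem (K.mul_mem haK (hv1K i)) (K.mul_mem hbK (hw1K i))
  have hwK : ∀ i, w i ∈ K := by
    intro i; rw [hab']
    exact K.add_mem (K.mul_mem (K.sub_mem K.one_mem haK) (hv1K i))
      (K.mul_mem (K.sub_mem K.one_mem hbK) (hw1K i))
  refine ⟨fun x => ?_⟩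
  rw [← hKmem]
  apply hK
  have hle : Algebra.adjoin ℂ T ≤ K.toSubalgebra := by
    rw [Algebra.adjoin_le_iff]
    rintro _ (⟨i, rfl⟩ | ⟨i, rfl⟩)
    · exact hvK i
    · exact hwK i
  exact (gp.alg.1 x).tower_top_of_subalgebra_le hle

end ProjGeo
end

section
namespace ProjGeo

lemma nondeg_lin {r : ℕ} {X : Set (Pt r)} (hX : Nondeg X)
    (l : (Fin (r + 1) → ℂ) →ₗ[ℂ] ℂ) (hl : ∀ v ∈ Cone X, l v = 0) : l = 0 := by
  have h1 : (⊤ : Submodule ℂ (Fin (r + 1) → ℂ)) ≤ LinearMap.ker l := by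
    rw [← hX]
    unfold projSpan
    refine iSup₂_le fun x hx => ?_
    intro v hv
    rw [LinearMap.mem_ker]
    apply hl
    intro hv0
    rw [Projectivization.submodule_eq, Submodule.mem_span_singleton] at hv
    obtain ⟨c, rfl⟩ := hv
    have : Projectivization.mk ℂ (c • x.rep) hv0 = x := by
      conv_rhs => rw [← x.mk_rep]
      rw [Projectivization.mk_eq_mk_iff']
      exact ⟨c, rfl⟩
    rwa [this]
  ext i
  exact h1 (Submodule.mem_top)

lemma not_const_ratio {r : ℕ} (hr : 1 ≤ r) {X : Set (Pt r)} (hX : Nondeg X) {Ω : Type*} [Field Ω]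
    [Algebra ℂ Ω] {w : Fin (r + 1) → Ω} (hw0 : w ≠ 0)
    (hg : ∀ g : MvPolynomial (Fin (r + 1)) ℂ, aeval w g = 0 → ∀ w0 ∈ Cone X, eval w0 g = 0)
    (hD : ∀ D : Derivation ℂ Ω Ω, ∃ c : Ω, ∀ i, D (w i) = c * w i) : False := by
  obtain ⟨j, hj⟩ := Function.ne_iff.1 hw0
  change w j ≠ 0 at hj
  have hc : ∀ i, ∃ c : ℂ, w i / w j = algebraMap ℂ Ω c := by
    intro i
    apply const_of_deriv
    intro D
    obtain ⟨c, hc⟩ := hD D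
    have h1 : w i / w j * w j = w i := div_mul_cancel₀ _ hj
    have h2 := congrArg D h1
    rw [D.leibniz, hc, hc, smul_eq_mul, smul_eq_mul] at h2
    have h3 : w j * D (w i / w j) = 0 := by
      linear_combination h2 - c * h1
    exact (mul_eq_zero.1 h3).resolve_left hj
  have : Nontrivial (Fin (r + 1)) := Fin.nontrivial_iff_two_le.2 (by omega)
  obtain ⟨i, hij⟩ := exists_ne j
  obtain ⟨c, hc⟩ := hc i
  have h1 := nondeg_lin hX (LinearMap.proj i - c • LinearMap.proj j) (by
    intro v hv
    have := hg (MvPolynomial.X i - MvPolynomial.C c * MvPolynomial.X j) (by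
      simp only [map_sub, map_mul, aeval_X, algHom_C]
      rw [← hc, div_mul_cancel₀ _ hj, sub_self]) v hv
    simpa using this)
  have h2 := LinearMap.congr_fun h1 (Pi.single i 1)
  simp [hij.symm] at h2

variable {r : ℕ} {X : Set (Pt r)} {h : MvPolynomial (Fin (r + 1)) ℂ} {Ω : Type} [Field Ω]
  [Algebra ℂ Ω] {v w : Fin (r + 1) → Ω}

lemma gp_inj (hs : Setup X h) (gp : GenericPair X Ω v w) [IsAlgClosed Ω]
    (D : Derivation ℂ Ω Ω) (hD : ∀ i, D (v i) + D (w i) = 0) : D = 0 := by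
  let k := IntermediateField.adjoin ℂ (Set.range fun i => v i + w i)
  have hk : ∀ i, v i + w i ∈ k := fun i =>
    IntermediateField.subset_adjoin _ _ ⟨i, rfl⟩
  haveI := gp_algebraic hs gp k hk
  refine (deriv_lift (A := k) (Ω := Ω)).2 D ?_
  rintro ⟨a, ha⟩
  change D a = 0
  induction ha using IntermediateField.adjoin_induction with
  | mem x hx => obtain ⟨i, rfl⟩ := hx; simpa using hD i
  | algebraMap x => simp
  | add x y _ _ hx hy => simp [hx, hy]
  | inv x _ hx => simp [Derivation.leibniz_inv, hx]
  | mul x y _ _ hx hy => simp [hx, hy]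

lemma gp_genv (hs : Setup X h) (gp : GenericPair X Ω v w) (g : MvPolynomial (Fin (r + 1)) ℂ)
    (hg : aeval v g = 0) : ∀ v0 ∈ Cone X, eval v0 g = 0 := by
  intro v0 hv0
  have := (gp.gen (rename Sum.inl g)).1 (by rw [aeval_rename]; simpa using hg) v0 hv0 v0 hv0
  rw [eval_rename] at this
  simpa using this

lemma gp_genw (hs : Setup X h) (gp : GenericPair X Ω v w) (g : MvPolynomial (Fin (r + 1)) ℂ)
    (hg : aeval w g = 0) : ∀ v0 ∈ Cone X, eval v0 g = 0 := by
  intro v0 hv0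
  have := (gp.gen (rename Sum.inr g)).1 (by rw [aeval_rename]; simpa using hg) v0 hv0 v0 hv0
  rw [eval_rename] at this
  simpa using this

lemma gp_swap (hs : Setup X h) (gp : GenericPair X Ω v w) [IsAlgClosed Ω]
    (σ : Ω ≃ₐ[ℂ] Ω) (hσ : ∀ i, σ (v i + w i) = v i + w i) :
    ((∀ i, σ (v i) = v i) ∧ ∀ i, σ (w i) = w i) ∨ ((∀ i, σ (v i) = w i) ∧ ∀ i, σ (w i) = v i) := by
  have hli := gp_linIndep hs gp gp.ptv gp.ptw rfl
  have hv2 : PtOver X (fun i => σ (v i)) := gp.ptv.map (σ : Ω →ₐ[ℂ] Ω)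
  have hw2 : PtOver X (fun i => σ (w i)) := gp.ptw.map (σ : Ω →ₐ[ℂ] Ω)
  have hsum : v + w = (fun i => σ (v i)) + fun i => σ (w i) := by
    ext i; simp only [Pi.add_apply]; rw [← map_add, hσ]
  have hh : aeval (v + w) h ≠ 0 := fun h0 => hs.h0 (gp_indep hs gp h0)
  have hli2 := gp_linIndep hs gp hv2 hw2 hsum
  obtain ⟨a, b, hab⟩ := hs.uniq.generic hs.irr.2.1 gp.ptv gp.ptw hv2 hw2 hsum hh hli hli2
  have h1 : ∀ i, σ (v i) = a * v i + b * w i := fun i => by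
    have := congrFun hab i; simpa using this
  have h2 : ∀ i, σ (w i) = (1 - a) * v i + (1 - b) * w i := fun i => by
    have := congrFun hsum i
    simp only [Pi.add_apply] at this
    linear_combination -this - h1 i
  have hw0 : w ≠ 0 := hli.ne_zero 1
  have hv0 : v ≠ 0 := hli.ne_zero 0
  have hinj := gp_inj hs gp
  have key1 : ¬ (a ≠ 0 ∧ b ≠ 0) := by
    rintro ⟨ha, hb⟩
    exact not_const_ratio hs.hr hs.nondeg hw0 (gp_genw hs gp)
      (trisecant v w hinj gp.split gp.eulv gp.eulw σ a b ha hb h1)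
  have key2 : ¬ (1 - a ≠ 0 ∧ 1 - b ≠ 0) := by
    rintro ⟨ha, hb⟩
    refine not_const_ratio hs.hr hs.nondeg hv0 (gp_genv hs gp)
      (trisecant w v (fun D hD => hinj D fun i => by rw [add_comm, hD]) ?_ gp.eulw gp.eulv σ
        (1 - b) (1 - a) hb ha fun i => by rw [h2 i]; ring)
    intro D
    obtain ⟨D1, h3, h4⟩ := gp.split D
    exact ⟨D - D1, fun i => by simp [h4], fun i => by simp [h3]⟩
  have hindep := LinearIndependent.pair_iff.1 hli2
  by_cases ha : a = 0
  · by_cases hb : b = 0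
    · exact absurd (_root_.funext fun i => by simp [h1, ha, hb]) (hli2.ne_zero 0)
    · have hb1 : 1 - b = 0 := by
        by_contra hc
        exact key2 ⟨by simp [ha], hc⟩
      right
      have hb1' : b = 1 := by linear_combination -hb1
      exact ⟨fun i => by simp [h1, ha, hb1'], fun i => by simp [h2, ha, hb1']⟩
  · have hb : b = 0 := by
      by_contra hb
      exact key1 ⟨ha, hb⟩
    have ha1 : 1 - a = 0 := by
      by_contra hc
      exact key2 ⟨hc, by simp [hb]⟩
    left
    have ha1' : a = 1 := by linear_combination -ha1
    exact ⟨fun i => by simp [h1, ha1', hb], fun i => by simp [h2, ha1', hb]⟩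

lemma rational_sum (hs : Setup X h) (a b : MvPolynomial (Fin (r + 1)) ℂ)
    (hb : b ∉ II X) : ∃ N Dn : MvPolynomial (Fin (r + 1)) ℂ, Dn ≠ 0 ∧ IsRelPrime N Dn ∧
      ∀ v ∈ Cone X, ∀ w ∈ Cone X, eval (v + w) N * eval v b * eval w b =
        eval (v + w) Dn * (eval v a * eval w b + eval w a * eval v b) := by
  obtain ⟨Ω, _, _, _, v, w, gp⟩ := exists_genericPair hs.irr
  let k := IntermediateField.adjoin ℂ (Set.range (v + w))
  have hk : ∀ i, v i + w i ∈ k := fun i =>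
    IntermediateField.subset_adjoin _ _ ⟨i, rfl⟩
  haveI := gp_algebraic hs gp k hk
  have hbv : aeval v b ≠ 0 := fun h0 => hb ((mem_II_iff hs.irr.1 _).2 (gp_genv hs gp b h0))
  have hbw : aeval w b ≠ 0 := fun h0 => hb ((mem_II_iff hs.irr.1 _).2 (gp_genw hs gp b h0))
  have hmem : aeval v a / aeval v b + aeval w a / aeval w b ∈ k := by
    have : aeval v a / aeval v b + aeval w a / aeval w b ∈ (⊥ : IntermediateField k Ω) := by
      haveI : IsAlgClosure k Ω := ⟨inferInstance, inferInstance⟩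
      haveI : Normal k Ω := IsAlgClosure.normal k Ω
      haveI : IsGalois k Ω := IsGalois.mk
      rw [InfiniteGalois.mem_bot_iff_fixed]
      intro σ
      have h1 : ∀ (u : Fin (r + 1) → Ω) (g : MvPolynomial (Fin (r + 1)) ℂ), σ (aeval u g) = aeval (fun i => σ (u i)) g := by
        intro u g
        exact MvPolynomial.comp_aeval_apply u ((AlgEquiv.restrictScalars ℂ σ : Ω ≃ₐ[ℂ] Ω) : Ω →ₐ[ℂ] Ω) g
      simp only [map_add, map_div₀, h1]
      rcases gp_swap hs gp (σ.restrictScalars ℂ) (fun i => σ.commutes ⟨_, hk i⟩) with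
        ⟨h2, h3⟩ | ⟨h2, h3⟩
      · rw [show (fun i => σ (v i)) = v from _root_.funext h2,
          show (fun i => σ (w i)) = w from _root_.funext h3]
      · rw [show (fun i => σ (v i)) = w from _root_.funext h2,
          show (fun i => σ (w i)) = v from _root_.funext h3, add_comm]
    rw [IntermediateField.mem_bot] at this
    obtain ⟨y, hy⟩ := this
    rw [← hy]; exact y.2
  rw [IntermediateField.mem_adjoin_range_iff] at hmem
  obtain ⟨N0, D0, hND⟩ := hmem
  obtain ⟨N1, D1, hD1, hND⟩ : ∃ N1 D1 : MvPolynomial (Fin (r + 1)) ℂ, D1 ≠ 0 ∧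
      aeval v a / aeval v b + aeval w a / aeval w b = aeval (v + w) N1 / aeval (v + w) D1 := by
    by_cases hD : D0 = 0
    · exact ⟨0, 1, one_ne_zero, by rw [hND, hD]; simp⟩
    · exact ⟨N0, D0, hD, hND⟩
  obtain ⟨N, D, c, hrel, rfl, rfl⟩ := UniqueFactorizationMonoid.exists_reduced_factors' N1 D1 hD1
  have hc : c ≠ 0 := left_ne_zero_of_mul hD1
  have hD : D ≠ 0 := right_ne_zero_of_mul hD1
  have hc' : aeval (v + w) c ≠ 0 := fun h0 => hc (gp_indep hs gp h0)
  have hD' : aeval (v + w) D ≠ 0 := fun h0 => hD (gp_indep hs gp h0)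
  refine ⟨N, D, hD, hrel, ?_⟩
  rw [map_mul, map_mul, mul_div_mul_left _ _ hc', div_add_div _ _ hbv hbw,
    div_eq_div_iff (mul_ne_zero hbv hbw) hD'] at hND
  let S : MvPolynomial (Fin (r + 1)) ℂ →ₐ[ℂ] MvPolynomial (Fin (r + 1) ⊕ Fin (r + 1)) ℂ :=
    aeval (fun i => MvPolynomial.X (Sum.inl i) + MvPolynomial.X (Sum.inr i))
  have hS : ∀ {A : Type} [CommRing A] [Algebra ℂ A] (v w : Fin (r + 1) → A) (g : MvPolynomial (Fin (r + 1)) ℂ),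
      aeval (Sum.elim v w) (S g) = aeval (v + w) g := by
    intro A _ _ v w g
    refine (MvPolynomial.comp_aeval_apply _ (aeval (Sum.elim v w)) g).trans ?_
    congr 2
    ext i; simp
  have hl : ∀ {A : Type} [CommRing A] [Algebra ℂ A] (v w : Fin (r + 1) → A) (g : MvPolynomial (Fin (r + 1)) ℂ),
      aeval (Sum.elim v w) (rename Sum.inl g) = aeval v g := by
    intro A _ _ v w g
    rw [aeval_rename]; rfl
  have hr' : ∀ {A : Type} [CommRing A] [Algebra ℂ A] (v w : Fin (r + 1) → A) (g : MvPolynomial (Fin (r + 1)) ℂ),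
      aeval (Sum.elim v w) (rename Sum.inr g) = aeval w g := by
    intro A _ _ v w g
    rw [aeval_rename]; rfl
  have := (gp.gen (S N * rename Sum.inl b * rename Sum.inr b - S D *
    (rename Sum.inl a * rename Sum.inr b + rename Sum.inr a * rename Sum.inl b))).1 (by
      simp only [map_sub, map_mul, map_add, hS, hl, hr']
      linear_combination -hND)
  intro v0 hv0 w0 hw0
  have h1 := this v0 hv0 w0 hw0
  rw [← coe_aeval_eq_eval] at h1
  change aeval _ _ = _ at h1
  simp only [map_sub, map_mul, map_add, hS, hl, hr'] at h1
  simp only [← coe_aeval_eq_eval]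
  exact sub_eq_zero.1 h1

end ProjGeo
end

section
namespace ProjGeo

/-- a locally regular function of degree one on the cone -/
structure LocReg {r : ℕ} (X : Set (Pt r)) (φ : (Fin (r + 1) → ℂ) → ℂ) : Prop where
  loc : ∀ v0 ∈ Cone X, v0 ≠ 0 → ∃ a b : MvPolynomial (Fin (r + 1)) ℂ, eval v0 b ≠ 0 ∧
    ∀ u ∈ Cone X, eval u b * φ u = eval u a
  hom : ∀ u ∈ Cone X, ∀ c : ℂ, φ (c • u) = c * φ u

variable {r : ℕ} {X : Set (Pt r)} {φ : (Fin (r + 1) → ℂ) → ℂ}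

lemma LocReg.zero (hφ : LocReg X φ) : φ 0 = 0 := by
  have := hφ.hom 0 zero_mem_Cone 0
  simpa using this

lemma analyticAt_eval (g : MvPolynomial (Fin (r + 1)) ℂ) (x : Fin (r + 1) → ℂ) :
    AnalyticAt ℂ (fun u => eval u g) x :=
  AnalyticOnNhd.eval_continuousLinearMap (ContinuousLinearMap.id ℂ (Fin (r + 1) → ℂ)) g x trivial

open Topology in
lemma LocReg.lip_compact (hφ : LocReg X φ) (hX : IsIrrVar X) :
    ∃ K : NNReal, LipschitzOnWith K φ
      (Cone X ∩ (Metric.closedBall 0 1 \ Metric.ball 0 (1 / 2))) := by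
  have hc : IsCompact (Cone X ∩ (Metric.closedBall 0 1 \ Metric.ball 0 (1 / 2))) :=
    ((isCompact_closedBall (0 : Fin (r + 1) → ℂ) 1).diff Metric.isOpen_ball).inter_left
      (isClosed_Cone hX.1 hX.2.1)
  refine LocallyLipschitzOn.exists_lipschitzOnWith_of_compact hc ?_
  rintro x ⟨hx, -, hx2⟩
  have hx0 : x ≠ 0 := by
    rintro rfl; exact hx2 (by simp)
  obtain ⟨a, b, hb, hab⟩ := hφ.loc x hx hx0
  have hcd : ContDiffAt ℂ 1 (fun u => eval u a / eval u b) x :=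
    ((analyticAt_eval a x).div (analyticAt_eval b x) hb).contDiffAt
  obtain ⟨K, t, ht, hK⟩ := hcd.exists_lipschitzOnWith
  have hb' : {u | eval u b ≠ 0} ∈ 𝓝 x :=
    (isOpen_ne_fun (MvPolynomial.continuous_eval b) continuous_const).mem_nhds hb
  refine ⟨K, (Cone X ∩ (Metric.closedBall 0 1 \ Metric.ball 0 (1 / 2))) ∩ (t ∩ {u | eval u b ≠ 0}),
    inter_mem_nhdsWithin _ (Filter.inter_mem ht hb'), ?_⟩
  have he : ∀ u ∈ (Cone X ∩ (Metric.closedBall 0 1 \ Metric.ball 0 (1 / 2))) ∩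
      (t ∩ {u | eval u b ≠ 0}), φ u = eval u a / eval u b := by
    rintro u ⟨⟨hu, -⟩, -, hu2⟩
    rw [eq_div_iff hu2, mul_comm, hab u hu]
  intro u hu u' hu'
  rw [he u hu, he u' hu']
  exact hK hu.2.1 hu'.2.1

lemma LocReg.lip (hφ : LocReg X φ) (hX : IsIrrVar X) :
    ∃ M : ℝ, 0 ≤ M ∧ ∀ u1 ∈ Cone X, ∀ u2 ∈ Cone X, ‖φ u1 - φ u2‖ ≤ M * ‖u1 - u2‖ := by
  obtain ⟨K, hK⟩ := hφ.lip_compact hX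
  -- bound on the unit sphere
  have hB : ∃ B : ℝ, 0 ≤ B ∧ ∀ u ∈ Cone X, ‖u‖ = 1 → ‖φ u‖ ≤ B := by
    by_cases hne : ∃ u0 ∈ Cone X, ‖u0‖ = 1
    · obtain ⟨u0, hu0, hn0⟩ := hne
      refine ⟨‖φ u0‖ + K * 2, by positivity, fun u hu hn => ?_⟩
      have h1 := hK.dist_le_mul u ⟨hu, by simp [hn], by simp [hn]; norm_num⟩ u0
        ⟨hu0, by simp [hn0], by simp [hn0]; norm_num⟩
      have h2 : dist u u0 ≤ 2 := by
        rw [dist_eq_norm]; have := norm_sub_le u u0; linarith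
      have h3 : ‖φ u‖ ≤ ‖φ u0‖ + dist (φ u) (φ u0) := by
        rw [dist_eq_norm]
        have := norm_add_le (φ u0) (φ u - φ u0)
        simpa using this
      have h4 : (K : ℝ) * dist u u0 ≤ K * 2 := by gcongr
      linarith
    · push Not at hne
      exact ⟨0, le_rfl, fun u hu hn => absurd hn (hne u hu)⟩
  obtain ⟨B, hB0, hB⟩ := hB
  have hBall : ∀ u ∈ Cone X, ‖φ u‖ ≤ B * ‖u‖ := by
    intro u hu
    by_cases h0 : u = 0
    · subst h0; simp [hφ.zero]
    have hn : ‖u‖ ≠ 0 := norm_ne_zero_iff.2 h0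
    have h1 := hB (((‖u‖ : ℂ)⁻¹) • u) (smul_mem_Cone hu _) (by
      rw [norm_smul, norm_inv, Complex.norm_real, norm_norm, inv_mul_cancel₀ hn])
    rw [hφ.hom u hu, norm_mul, norm_inv, Complex.norm_real, norm_norm] at h1
    rw [inv_mul_le_iff₀ (by positivity)] at h1
    linarith
  refine ⟨K + 4 * B, by positivity, ?_⟩
  have main : ∀ u1 ∈ Cone X, ∀ u2 ∈ Cone X, ‖u1‖ = 1 → ‖u2‖ ≤ 1 →
      ‖φ u1 - φ u2‖ ≤ (K + 4 * B) * ‖u1 - u2‖ := by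
    intro u1 h1 u2 h2 hn1 hn2
    by_cases hh : 1 / 2 ≤ ‖u2‖
    · have h3 := hK.dist_le_mul u1 ⟨h1, by simp [hn1], by simp [hn1]; norm_num⟩ u2
        ⟨h2, by simp [hn2], by simpa using hh⟩
      rw [dist_eq_norm, dist_eq_norm] at h3
      have := mul_nonneg hB0 (norm_nonneg (u1 - u2))
      linarith
    · push Not at hh
      have h3 := norm_sub_norm_le u1 u2
      have h4 := norm_sub_le (φ u1) (φ u2)
      have h5 := hBall u1 h1
      have h6 := hBall u2 h2
      have h7 := mul_nonneg K.2 (norm_nonneg (u1 - u2))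
      change 0 ≤ (K : ℝ) * _ at h7
      nlinarith
  have main2 : ∀ u1 ∈ Cone X, ∀ u2 ∈ Cone X, ‖u2‖ ≤ ‖u1‖ →
      ‖φ u1 - φ u2‖ ≤ (K + 4 * B) * ‖u1 - u2‖ := by
    intro u1 h1 u2 h2 hn
    by_cases h0 : u1 = 0
    · subst h0
      have : u2 = 0 := by simpa using hn
      subst this; simp
    have hn0 : ‖u1‖ ≠ 0 := norm_ne_zero_iff.2 h0
    have hpos : 0 < ‖u1‖ := norm_pos_iff.2 h0
    have h3 := main _ (smul_mem_Cone h1 ((‖u1‖ : ℂ)⁻¹)) _ (smul_mem_Cone h2 ((‖u1‖ : ℂ)⁻¹)) (by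
      rw [norm_smul, norm_inv, Complex.norm_real, norm_norm, inv_mul_cancel₀ hn0]) (by
      rw [norm_smul, norm_inv, Complex.norm_real, norm_norm, inv_mul_le_iff₀ hpos]; linarith)
    rw [hφ.hom _ h1, hφ.hom _ h2, ← mul_sub, ← smul_sub, norm_mul, norm_smul, norm_inv,
      Complex.norm_real, norm_norm, inv_mul_le_iff₀ hpos] at h3
    refine h3.trans (le_of_eq ?_)
    field_simp
  intro u1 h1 u2 h2
  rcases le_total ‖u2‖ ‖u1‖ with hh | hh
  · exact main2 u1 h1 u2 h2 hh
  · rw [norm_sub_rev, norm_sub_rev u1]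
    exact main2 u2 h2 u1 h1 hh

lemma LocReg.lip_add (hφ : LocReg X φ) (hX : IsIrrVar X) :
    ∃ M : ℝ, ∀ u1 ∈ Cone X, ∀ u2 ∈ Cone X, ‖φ u1 + φ u2‖ ≤ M * ‖u1 + u2‖ := by
  obtain ⟨M, -, hM⟩ := hφ.lip hX
  refine ⟨M, fun u1 h1 u2 h2 => ?_⟩
  have := hM u1 h1 _ (smul_mem_Cone h2 (-1))
  rw [hφ.hom _ h2] at this
  simpa using this

lemma cone_dense (hX : IsIrrVar X) {b G : MvPolynomial (Fin (r + 1)) ℂ} (hb : b ∉ II X)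
    (hG : ∀ w ∈ Cone X, eval w b ≠ 0 → eval w G = 0) : ∀ w ∈ Cone X, eval w G = 0 := by
  rw [← mem_II_iff hX.1]
  haveI := II_isPrime hX
  have : b * G ∈ II X := by
    rw [mem_II_iff hX.1]
    intro w hw
    rw [map_mul]
    by_cases h : eval w b = 0
    · simp [h]
    · simp [hG w hw h]
  exact ((II_isPrime hX).mem_or_mem this).resolve_left hb

lemma extend_id (hφ : LocReg X φ) (hX : IsIrrVar X) {b N D : MvPolynomial (Fin (r + 1)) ℂ}
    (hb : b ∉ II X) (v : Fin (r + 1) → ℂ) (c : ℂ)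
    (hid : ∀ w ∈ Cone X, eval w b ≠ 0 → eval (v + w) N = eval (v + w) D * (c + φ w)) :
    ∀ w ∈ Cone X, eval (v + w) N = eval (v + w) D * (c + φ w) := by
  have h1 : ∀ w ∈ Cone X, w ≠ 0 → eval (v + w) N = eval (v + w) D * (c + φ w) := by
    intro w hw hw0
    obtain ⟨a', b', hb', hab'⟩ := hφ.loc w hw hw0
    let T : MvPolynomial (Fin (r + 1)) ℂ →ₐ[ℂ] MvPolynomial (Fin (r + 1)) ℂ :=
      aeval (fun i => C (v i) + MvPolynomial.X i)
    have hT : ∀ u g, eval u (T g) = eval (v + u) g := by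
      intro u g
      simp only [← coe_aeval_eq_eval]
      refine (MvPolynomial.comp_aeval_apply _ (aeval u) g).trans ?_
      have : (fun i => aeval u (C (v i) + MvPolynomial.X i)) = v + u := by
        ext i; simp
      rw [this]; rfl
    have := cone_dense hX hb (G := T N * b' - T D * (C c * b' + a')) (by
      intro u hu hbu
      simp only [map_sub, map_mul, map_add, hT, eval_C]
      rw [hid u hu hbu, ← hab' u hu]
      ring) w hw
    simp only [map_sub, map_mul, map_add, hT, eval_C] at this
    rw [← hab' w hw] at this
    apply mul_left_cancel₀ hb'
    linear_combination this
  intro w hw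
  by_cases hw0 : w = 0
  · obtain ⟨u, hu, hu0⟩ := exists_ne_zero_mem_Cone hX.1
    have hcont : ∀ g : MvPolynomial (Fin (r + 1)) ℂ, Continuous (fun t : ℂ => eval (v + t • u) g) :=
      fun g => (MvPolynomial.continuous_eval g).comp (by fun_prop)
    have h2 : (fun t : ℂ => eval (v + t • u) N) =
        fun t : ℂ => eval (v + t • u) D * (c + t * φ u) := by
      refine Continuous.ext_on (dense_compl_singleton (0 : ℂ)) (hcont N)
        ((hcont D).mul (by fun_prop)) ?_
      intro t ht
      have := h1 (t • u) (smul_mem_Cone hu t) (smul_ne_zero ht hu0)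
      rw [hφ.hom u hu] at this
      exact this
    have := congrFun h2 0
    simpa [hw0, hφ.zero] using this
  · exact h1 w hw hw0

lemma dense_ne {h : MvPolynomial (Fin (r + 1)) ℂ} (h0 : h ≠ 0) :
    Dense {p : Fin (r + 1) → ℂ | eval p h ≠ 0} := by
  obtain ⟨q, hq⟩ : ∃ q, eval q h ≠ 0 := by
    by_contra hcon
    push Not at hcon
    exact h0 (MvPolynomial.funext fun x => by simp [hcon x])
  intro p
  let H : Polynomial ℂ := aeval (fun i => Polynomial.C (p i) + Polynomial.X * Polynomial.C (q i - p i)) h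
  have hH : ∀ t, Polynomial.eval t H = eval (p + t • (q - p)) h := by
    intro t
    simp only [← coe_aeval_eq_eval, ← Polynomial.coe_aeval_eq_eval]
    refine (MvPolynomial.comp_aeval_apply _ (Polynomial.aeval t) h).trans ?_
    have : (fun i => Polynomial.aeval t (Polynomial.C (p i) + Polynomial.X *
        Polynomial.C (q i - p i))) = p + t • (q - p) := by
      ext i; simp
    rw [this]; rfl
  have hH0 : H ≠ 0 := by
    intro h1
    apply hq
    have := hH 1
    rw [h1] at this
    simpa using this.symm
  have hfin : {t : ℂ | Polynomial.eval t H = 0}.Finite := by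
    refine (H.roots.toFinset.finite_toSet).subset fun t ht => ?_
    simpa [hH0] using ht
  have hd : Dense ({t : ℂ | Polynomial.eval t H = 0}ᶜ) := hfin.countable.dense_compl ℂ
  have hc : Continuous (fun t : ℂ => p + t • (q - p)) := by fun_prop
  have h2 := image_closure_subset_closure_image hc (s := {t : ℂ | Polynomial.eval t H = 0}ᶜ)
    ⟨0, hd 0, rfl⟩
  simp only [zero_smul, add_zero] at h2
  refine closure_mono ?_ h2
  rintro _ ⟨t, ht, rfl⟩
  change ¬ _ at ht
  simpa [hH] using ht

lemma LocReg.linear {h : MvPolynomial (Fin (r + 1)) ℂ} (hs : Setup X h) (hφ : LocReg X φ) :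
    ∃ l : (Fin (r + 1) → ℂ) →ₗ[ℂ] ℂ, ∀ u ∈ Cone X, φ u = l u := by
  have hX := hs.irr
  obtain ⟨u, hu, hu0⟩ := exists_ne_zero_mem_Cone hX.1
  obtain ⟨a, b, hb, hab⟩ := hφ.loc u hu hu0
  have hb' : b ∉ II X := fun hmem => hb ((mem_II_iff hX.1 b).1 hmem u hu)
  obtain ⟨N, D, hD0, hrel, hND⟩ := rational_sum hs a b hb'
  have h1 : ∀ v ∈ Cone X, eval v b ≠ 0 → ∀ w ∈ Cone X,
      eval (v + w) N = eval (v + w) D * (φ v + φ w) := by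
    intro v hv hbv
    refine extend_id hφ hX hb' v (φ v) ?_
    intro w hw hbw
    have := hND v hv w hw
    rw [← hab v hv, ← hab w hw] at this
    apply mul_left_cancel₀ (mul_ne_zero hbv hbw)
    linear_combination this
  have h2 : ∀ v ∈ Cone X, ∀ w ∈ Cone X,
      eval (v + w) N = eval (v + w) D * (φ v + φ w) := by
    intro v hv
    refine extend_id hφ hX hb' v (φ v) ?_
    intro w hw hbw
    have := h1 w hw hbw v hv
    rwa [add_comm w v, add_comm (φ w)] at this
  obtain ⟨M, hM⟩ := hφ.lip_add hX
  have h3 : ∀ p, ‖eval p N‖ ≤ ‖eval p D‖ * (M * ‖p‖) := by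
    have hcl : IsClosed {p : Fin (r + 1) → ℂ | ‖eval p N‖ ≤ ‖eval p D‖ * (M * ‖p‖)} := by
      have := MvPolynomial.continuous_eval N
      have := MvPolynomial.continuous_eval D
      exact isClosed_le (by fun_prop) (by fun_prop)
    intro p
    refine hcl.closure_subset_iff.2 ?_ (dense_ne hs.h0 p)
    intro p hp
    obtain ⟨v, hv, w, hw, rfl⟩ := hs.dense p hp
    change ‖_‖ ≤ _
    rw [h2 v hv w hw, norm_mul]
    gcongr
    exact hM v hv w hw
  have h4 : N ∈ (Ideal.span {D}).radical := by
    rw [← MvPolynomial.vanishingIdeal_zeroLocus_eq_radical (K := ℂ)]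
    rw [mem_vanishingIdeal_iff]
    intro p hp
    have : eval p D = 0 := hp D (Ideal.mem_span_singleton_self D)
    have h5 := h3 p
    rw [this] at h5
    simpa using h5
  obtain ⟨m, hm⟩ := h4
  rw [Ideal.mem_span_singleton] at hm
  have hunit : IsUnit D := (hrel.pow_left (m := m)) hm dvd_rfl
  obtain ⟨d, hd, rfl⟩ := MvPolynomial.isUnit_iff_eq_C_of_isReduced.1 hunit
  have hd0 : d ≠ 0 := hd.ne_zero
  let Q := C d⁻¹ * N
  have hQ : ∀ v ∈ Cone X, φ v = eval v Q := by
    intro v hv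
    have := h2 v hv 0 zero_mem_Cone
    simp only [add_zero, hφ.zero, eval_C] at this
    simp only [Q, map_mul, eval_C, this]
    field_simp
  have hfd : HasFDerivAt (fun p => eval p Q) (fderiv ℂ (fun p => eval p Q) 0) (0 : Fin (r + 1) → ℂ) :=
    (analyticAt_eval Q 0).differentiableAt.hasFDerivAt
  refine ⟨(fderiv ℂ (fun p => eval p Q) (0 : Fin (r + 1) → ℂ)).toLinearMap, fun v hv => ?_⟩
  have hg : HasDerivAt (fun t : ℂ => t • v) v 0 := by
    simpa using (hasDerivAt_id (0 : ℂ)).smul_const v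
  have h6 : HasDerivAt (fun t : ℂ => eval (t • v) Q) (fderiv ℂ (fun p => eval p Q) 0 v) 0 := by
    have hfd' : HasFDerivAt (fun p => eval p Q) (fderiv ℂ (fun p => eval p Q) 0) ((0 : ℂ) • v) := by
      rw [zero_smul]; exact hfd
    exact HasFDerivAt.comp_hasDerivAt (0 : ℂ) hfd' hg
  have h7 : (fun t : ℂ => eval (t • v) Q) = fun t => t * φ v := by
    ext t
    rw [← hQ _ (smul_mem_Cone hv t), hφ.hom v hv]
  rw [h7] at h6
  have h8 : HasDerivAt (fun t : ℂ => t * φ v) (φ v) 0 := by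
    simpa using (hasDerivAt_id (0 : ℂ)).mul_const (φ v)
  exact h8.unique h6

end ProjGeo
end

section
namespace ProjGeo

lemma homComp_mul {r : ℕ} {F : MvPolynomial (Fin (r + 1)) ℂ} (hF : F.IsHomogeneous 1)
    (g : MvPolynomial (Fin (r + 1)) ℂ) (n : ℕ) :
    homogeneousComponent (n + 1) (F * g) = F * homogeneousComponent n g := by
  conv_lhs => rw [← sum_homogeneousComponent g, Finset.mul_sum, map_sum]
  have h1 : ∀ i, homogeneousComponent (n + 1) (F * homogeneousComponent i g) =
      if n = i then F * homogeneousComponent n g else 0 := by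
    intro i
    have : F * homogeneousComponent i g ∈ homogeneousSubmodule (Fin (r + 1)) ℂ (i + 1) := by
      rw [add_comm i 1]
      exact hF.mul (homogeneousComponent_isHomogeneous i g)
    rw [homogeneousComponent_of_mem this]
    by_cases h : n = i
    · subst h; simp
    · rw [if_neg (by omega), if_neg h]
  simp only [h1]
  rw [Finset.sum_ite_eq]
  split_ifs with h2
  · rfl
  · rw [homogeneousComponent_eq_zero _ _ (by simpa using h2), mul_zero]

/-- the linear form as a polynomial -/
def linPoly {s : ℕ} (l : (Fin (s + 1) → ℂ) →ₗ[ℂ] ℂ) : MvPolynomial (Fin (s + 1)) ℂ :=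
  ∑ j, C (l (Pi.single j 1)) * MvPolynomial.X j

lemma linPoly_hom {s : ℕ} (l : (Fin (s + 1) → ℂ) →ₗ[ℂ] ℂ) : (linPoly l).IsHomogeneous 1 := by
  refine IsHomogeneous.sum _ _ _ fun j _ => ?_
  have := (isHomogeneous_C (Fin (s + 1)) (l (Pi.single j 1))).mul (isHomogeneous_X ℂ j)
  simpa using this

lemma eval_linPoly {s : ℕ} (l : (Fin (s + 1) → ℂ) →ₗ[ℂ] ℂ) (v : Fin (s + 1) → ℂ) :
    eval v (linPoly l) = l v := by
  conv_rhs => rw [← LinearMap.sum_single_apply (fun _ => ℂ) v]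
  simp only [linPoly, map_sum, map_mul, eval_C, eval_X]
  refine Finset.sum_congr rfl fun j _ => ?_
  rw [mul_comm, ← smul_eq_mul, ← map_smul]
  congr 1
  ext i
  simp [Pi.single_apply]

variable {r s : ℕ} {X : Set (Pt r)} {X' : Set (Pt s)}

/-- coordinate forms of a linear map -/
def coordPoly (f : (Fin (s + 1) → ℂ) →ₗ[ℂ] (Fin (r + 1) → ℂ)) (i : Fin (r + 1)) :
    MvPolynomial (Fin (s + 1)) ℂ := linPoly ((LinearMap.proj i).comp f)

/-- pull back of polynomials -/
def pull (f : (Fin (s + 1) → ℂ) →ₗ[ℂ] (Fin (r + 1) → ℂ)) :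
    MvPolynomial (Fin (r + 1)) ℂ →ₐ[ℂ] MvPolynomial (Fin (s + 1)) ℂ := aeval (coordPoly f)

lemma eval_pull (f : (Fin (s + 1) → ℂ) →ₗ[ℂ] (Fin (r + 1) → ℂ)) (g : MvPolynomial (Fin (r + 1)) ℂ)
    (v : Fin (s + 1) → ℂ) : eval v (pull f g) = eval (f v) g := by
  simp only [← coe_aeval_eq_eval]
  refine (MvPolynomial.comp_aeval_apply _ (aeval v) g).trans ?_
  have : (fun i => aeval v (coordPoly f i)) = f v := by
    ext i
    exact eval_linPoly ((LinearMap.proj i).comp f) v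
  rw [this]; rfl

/-- what we use about the projection -/
structure ProjData (f : (Fin (s + 1) → ℂ) →ₗ[ℂ] (Fin (r + 1) → ℂ)) (X' : Set (Pt s))
    (X : Set (Pt r)) : Prop where
  irr' : IsIrrVar X'
  irr : IsIrrVar X
  ne : ∀ v ∈ Cone X', v ≠ 0 → f v ≠ 0
  map : ∀ v ∈ Cone X', f v ∈ Cone X
  surj : ∀ u ∈ Cone X, ∃ v ∈ Cone X', f v = u
  inj : ∃ h ∉ II X', ∀ v ∈ Cone X', ∀ w ∈ Cone X', eval v h ≠ 0 → eval w h ≠ 0 → f v = f w → v = w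

lemma ProjData.mk' {f : (Fin (s + 1) → ℂ) →ₗ[ℂ] (Fin (r + 1) → ℂ)} (hX' : IsIrrVar X')
    (hX : IsIrrVar X) (h : InducesBirMorphismOnto f X' X) : ProjData f X' X := by
  obtain ⟨h1, h2, A, hA, hXA, h3⟩ := h
  have hne : ∀ v ∈ Cone X', v ≠ 0 → f v ≠ 0 := fun v hv hv0 => h1 _ (hv hv0) v hv0 rfl
  have hzero : ∀ v ∈ Cone X', f v = 0 → v = 0 := fun v hv hf => by
    by_contra h0; exact hne v hv h0 hf
  refine ⟨hX', hX, hne, ?_, ?_, ?_⟩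
  · intro v hv hfv
    have hv0 : v ≠ 0 := by rintro rfl; simp at hfv
    rw [← h2]
    exact ⟨_, hv hv0, v, hv0, rfl, hfv, rfl⟩
  · intro u hu
    by_cases hu0 : u = 0
    · exact ⟨0, zero_mem_Cone, by simp [hu0]⟩
    have := hu hu0
    rw [← h2] at this
    obtain ⟨x, hx, v, hv0, rfl, hfv, he⟩ := this
    rw [Projectivization.mk_eq_mk_iff'] at he
    obtain ⟨a, ha⟩ := he
    have hvC : v ∈ Cone X' := fun _ => hx
    exact ⟨a • v, smul_mem_Cone hvC a, by rw [map_smul, ha]⟩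
  · obtain ⟨S, hS, rfl⟩ := hA
    obtain ⟨x, hx, hxA⟩ := Set.not_subset.1 hXA
    have : ∃ p ∈ S, ¬ VanishesAt p x := by
      by_contra hcon
      push Not at hcon
      exact hxA hcon
    obtain ⟨p, hp, hpx⟩ := this
    obtain ⟨d, hd⟩ := hS p hp
    refine ⟨p, ?_, ?_⟩
    · intro hmem
      apply hpx
      have := (mem_II_iff hX'.1 p).1 hmem x.rep ((mem_X_iff_rep x).1 hx)
      rw [← vanishesAt_iff hd _ x.rep_nonzero, Projectivization.mk_rep] at this
      exact this
    · intro v hv w hw hpv hpw hfe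
      by_cases hv0 : v = 0
      · subst hv0
        rw [map_zero] at hfe
        exact (hzero w hw hfe.symm).symm
      have hfv := hne v hv hv0
      have hw0 : w ≠ 0 := by
        rintro rfl; rw [map_zero] at hfe; exact hfv hfe
      have hfw := hne w hw hw0
      have nA : ∀ (u : Fin (s + 1) → ℂ) (hu : u ≠ 0), eval u p ≠ 0 →
          Projectivization.mk ℂ u hu ∉ ZeroLocus S := by
        intro u hu hpu hmem
        exact hpu ((vanishesAt_iff hd u hu).1 (hmem p hp))
      have := h3 _ ⟨hv hv0, nA v hv0 hpv⟩ _ ⟨hw hw0, nA w hw0 hpw⟩ (Projectivization.mk ℂ (f v) hfv)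
        ⟨v, hv0, rfl, hfv, rfl⟩ ⟨w, hw0, rfl, hfw, by simp only [hfe]⟩
      rw [Projectivization.mk_eq_mk_iff'] at this
      obtain ⟨a, ha⟩ := this
      have h5 : a • f w = f w := by rw [← map_smul, ha, hfe]
      have h6 : (a - 1) • f w = 0 := by rw [sub_smul, h5, one_smul, sub_self]
      have h7 : a = 1 := by
        rcases smul_eq_zero.1 h6 with h | h
        · exact sub_eq_zero.1 h
        · exact absurd h hfw
      rw [← ha, h7, one_smul]

lemma ProjData.nilp {f : (Fin (s + 1) → ℂ) →ₗ[ℂ] (Fin (r + 1) → ℂ)} (hd : ProjData f X' X)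
    (j : Fin (s + 1)) : ∃ n, ∃ g : Fin (r + 1) → MvPolynomial (Fin (s + 1)) ℂ,
      (∀ i, (g i).IsHomogeneous n) ∧
      (MvPolynomial.X j ^ (n + 1) - ∑ i, coordPoly f i * g i) ∈ II X' := by
  have h1 : MvPolynomial.X j ∈ (II X' ⊔ Ideal.span (Set.range (coordPoly f))).radical := by
    rw [← MvPolynomial.vanishingIdeal_zeroLocus_eq_radical (K := ℂ), mem_vanishingIdeal_iff]
    intro v hv
    have hvC : v ∈ Cone X' := mem_Cone_of_II hd.irr'.2.1 fun g hg =>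
      hv g (Ideal.mem_sup_left hg)
    have hfv : f v = 0 := by
      ext i
      have := hv (coordPoly f i) (Ideal.mem_sup_right (Ideal.subset_span ⟨i, rfl⟩))
      exact (eval_linPoly _ _).symm.trans this
    have hv0 : v = 0 := by
      by_contra h0; exact hd.ne v hvC h0 hfv
    simp [hv0]
  obtain ⟨n, hn⟩ := h1
  have hn1 : MvPolynomial.X j ^ (n + 1) ∈ II X' ⊔ Ideal.span (Set.range (coordPoly f)) := by
    rw [pow_succ]; exact Ideal.mul_mem_right _ _ hn
  obtain ⟨e, he, y, hy, hey⟩ := Submodule.mem_sup.1 hn1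
  rw [Ideal.mem_span_range_iff_exists_fun] at hy
  obtain ⟨c, hc⟩ := hy
  refine ⟨n, fun i => homogeneousComponent n (c i), fun i => homogeneousComponent_isHomogeneous _ _, ?_⟩
  have h2 : MvPolynomial.X j ^ (n + 1) - ∑ i, coordPoly f i * homogeneousComponent n (c i) =
      homogeneousComponent (n + 1) e := by
    have h3 : ∀ i, coordPoly f i * homogeneousComponent n (c i) =
        homogeneousComponent (n + 1) (c i * coordPoly f i) := by
      intro i
      rw [mul_comm (c i)]; exact (homComp_mul (linPoly_hom _) _ _).symm
    simp only [h3]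
    rw [← map_sum, hc]
    have h4 : homogeneousComponent (n + 1) (MvPolynomial.X j ^ (n + 1) : MvPolynomial (Fin (s + 1)) ℂ) =
        MvPolynomial.X j ^ (n + 1) :=
      homogeneousComponent_eq_self (isHomogeneous_X_pow j (n + 1))
    rw [← h4, ← hey, map_add, add_sub_cancel_right]
  rw [h2, mem_II_iff hd.irr'.1]
  intro v hv
  exact comps_vanish (fun t => (mem_II_iff hd.irr'.1 e).1 he _ (smul_mem_Cone hv t)) _

lemma integral_aux {ι A B : Type*} [Fintype ι] [CommRing A] [CommRing B] [Algebra A B] {s : ℕ}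
    (mk : MvPolynomial (Fin (s + 1)) ℂ →+* B) (hmk : Function.Surjective mk)
    (q : A → MvPolynomial (Fin (s + 1)) ℂ) (hq : ∀ a, mk (q a) = algebraMap A B a)
    (hC : ∀ c : ℂ, ∃ a, q a = C c) (x : ι → A) (n : Fin (s + 1) → ℕ)
    (g : Fin (s + 1) → ι → MvPolynomial (Fin (s + 1)) ℂ)
    (hg : ∀ j i, (g j i).IsHomogeneous (n j))
    (hmem : ∀ j, mk (MvPolynomial.X j ^ (n j + 1)) = mk (∑ i, q (x i) * g j i)) (y : B) :
    IsIntegral A y := by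
  have hsm : ∀ (a : A) (y : MvPolynomial (Fin (s + 1)) ℂ), mk (q a * y) = a • mk y := by
    intro a y
    rw [Algebra.smul_def, map_mul, hq]
  let m0 : Fin (s + 1) →₀ ℕ := Finsupp.equivFunOnFinite.symm n
  let T : Set B := (fun m => mk (monomial m 1)) '' Set.Iic m0
  have hT : T.Finite := (Set.finite_Iic m0).image _
  let M : Submodule A B := Submodule.span _ T
  have hmono : ∀ d, (∀ m : Fin (s + 1) →₀ ℕ, m.degree = d → mk (monomial m 1) ∈ M) →
      ∀ p : MvPolynomial (Fin (s + 1)) ℂ, p.IsHomogeneous d → mk p ∈ M := by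
    intro d hm p hp
    rw [p.as_sum, map_sum]
    refine M.sum_mem fun m hms => ?_
    obtain ⟨a, ha⟩ := hC (coeff m p)
    have h1 : monomial m (coeff m p) = q a * monomial m 1 := by
      simp only [ha, C_mul_monomial, mul_one]
    rw [h1, hsm]
    refine M.smul_mem _ (hm m ?_)
    have := hp (mem_support_iff.1 hms)
    rwa [Finsupp.degree_eq_weight_one]
  have hall : ∀ d, ∀ m : Fin (s + 1) →₀ ℕ, m.degree = d → mk (monomial m 1) ∈ M := by
    intro d
    induction d using Nat.strong_induction_on with
    | _ d ih =>
      intro m hmd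
      by_cases hle : m ≤ m0
      · exact Submodule.subset_span ⟨m, hle, rfl⟩
      · have : ∃ j, n j + 1 ≤ m j := by
          by_contra hcon
          push Not at hcon
          exact hle fun j => Nat.lt_succ_iff.1 (hcon j)
        obtain ⟨j, hj⟩ := this
        obtain ⟨m1, hm1⟩ : ∃ m1, m = Finsupp.single j (n j + 1) + m1 :=
          ⟨m - Finsupp.single j (n j + 1),
            (add_tsub_cancel_of_le (Finsupp.single_le_iff.2 hj)).symm⟩
        have hdeg : n j + 1 + m1.degree = d := by
          rw [← hmd, hm1, map_add, Finsupp.degree_single]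
        have h4 : (monomial m (1 : ℂ) : MvPolynomial (Fin (s + 1)) ℂ) =
            MvPolynomial.X j ^ (n j + 1) * monomial m1 1 := by
          rw [X_pow_eq_monomial, monomial_mul, ← hm1, mul_one]
        have h2 : mk (monomial m 1) = mk (∑ i, q (x i) * (g j i * monomial m1 1)) := by
          rw [h4, map_mul, hmem, ← map_mul, Finset.sum_mul]
          simp only [mul_assoc]
        rw [h2, map_sum]
        refine M.sum_mem fun i _ => ?_
        rw [hsm]
        refine M.smul_mem _ (hmono (n j + m1.degree) (ih _ (by omega)) _ ?_)
        exact (hg j i).mul (isHomogeneous_monomial _ rfl)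
  have htop : M = ⊤ := by
    rw [eq_top_iff]
    rintro y -
    obtain ⟨p, rfl⟩ := hmk y
    rw [← sum_homogeneousComponent p, map_sum]
    exact M.sum_mem fun i _ => hmono i (hall i) _ (homogeneousComponent_isHomogeneous i p)
  haveI : Module.Finite A B :=
    ⟨⟨hT.toFinset, by rw [hT.coe_toFinset]; exact htop⟩⟩
  exact Algebra.IsIntegral.isIntegral y

lemma ProjData.integral {f : (Fin (s + 1) → ℂ) →ₗ[ℂ] (Fin (r + 1) → ℂ)} (hd : ProjData f X' X)
    (l : (Fin (s + 1) → ℂ) →ₗ[ℂ] ℂ) :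
    ∃ P : Polynomial (MvPolynomial (Fin (r + 1)) ℂ), P.Monic ∧
      ∀ v ∈ Cone X', Polynomial.eval₂ (eval (f v)) (l v) P = 0 := by
  choose n g hg hmem using hd.nilp
  let mk := Ideal.Quotient.mk (II X')
  letI : Algebra (MvPolynomial (Fin (r + 1)) ℂ) (MvPolynomial (Fin (s + 1)) ℂ ⧸ II X') :=
    (mk.comp (pull f).toRingHom).toAlgebra
  obtain ⟨P, hP, hroot⟩ := integral_aux (A := MvPolynomial (Fin (r + 1)) ℂ) mk
    Ideal.Quotient.mk_surjective (fun a => pull f a)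
    (fun a => rfl) (fun c => ⟨C c, by simp [pull]⟩) (fun i => MvPolynomial.X i) n g hg (fun j => by
      have h3 : ∀ i, pull f (MvPolynomial.X i) = coordPoly f i := fun i => by simp [pull]
      simp only [h3]
      exact Ideal.Quotient.eq.2 (hmem j)) (mk (linPoly l))
  refine ⟨P, hP, fun v hv => ?_⟩
  have h1 : Polynomial.eval₂ (pull f).toRingHom (linPoly l) P ∈ II X' := by
    rw [← Ideal.Quotient.eq_zero_iff_mem, Polynomial.hom_eval₂]
    exact hroot
  have h2 := (mem_II_iff hd.irr'.1 _).1 h1 v hv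
  rw [Polynomial.hom_eval₂, eval_linPoly] at h2
  have he : eval (f v) = (eval v).comp (pull f).toRingHom :=
    RingHom.ext fun a => (eval_pull f a v).symm
  rw [he]
  exact h2

end ProjGeo
end

section
namespace ProjGeo

lemma exists_genericPoint_aux {r : ℕ} {X : Set (Pt r)}
    (R : Type) [CommRing R] [IsDomain R] [Algebra ℂ R] (x : Fin (r + 1) → R)
    (hsurj : ∀ a : R, ∃ g : MvPolynomial (Fin (r + 1)) ℂ, aeval x g = a)
    (hker : ∀ g : MvPolynomial (Fin (r + 1)) ℂ, aeval x g = 0 ↔ g ∈ II X) :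
    ∃ (Ω : Type) (_ : Field Ω) (_ : Algebra ℂ Ω) (_ : IsAlgClosed Ω) (v : Fin (r + 1) → Ω),
      (∀ g : MvPolynomial (Fin (r + 1)) ℂ, aeval v g = 0 ↔ g ∈ II X) ∧
      Algebra.IsAlgebraic (Algebra.adjoin ℂ (Set.range v)) Ω := by
  obtain ⟨Ω, _, _, _, _, _, _, _⟩ := exists_closure R
  let ι : R →ₐ[ℂ] Ω := IsScalarTower.toAlgHom ℂ R Ω
  have hιinj : Function.Injective ι := FaithfulSMul.algebraMap_injective R Ω
  refine ⟨Ω, inferInstance, inferInstance, inferInstance, fun i => ι (x i), fun g => ?_, ?_⟩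
  · rw [← MvPolynomial.comp_aeval_apply, map_eq_zero_iff _ hιinj, hker]
  · have hmem : ∀ a : R, ι a ∈ Algebra.adjoin ℂ (Set.range fun i => ι (x i)) := by
      intro a
      obtain ⟨g, rfl⟩ := hsurj a
      rw [MvPolynomial.comp_aeval_apply, Algebra.adjoin_range_eq_range_aeval]
      exact ⟨g, rfl⟩
    refine ⟨fun y => ?_⟩
    obtain ⟨p, hp, hy⟩ := Algebra.IsAlgebraic.isAlgebraic (R := R) y
    let j : R →+* Algebra.adjoin ℂ (Set.range fun i => ι (x i)) :=
      (ι : R →+* Ω).codRestrict _ hmem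
    refine ⟨p.map j, ?_, ?_⟩
    · refine (Polynomial.map_ne_zero_iff ?_).2 hp
      intro a b hab
      exact hιinj (congrArg Subtype.val hab)
    · rw [Polynomial.aeval_def, Polynomial.eval₂_map]
      exact hy

lemma exists_genericPoint {r : ℕ} {X : Set (Pt r)} (hX : IsIrrVar X) :
    ∃ (Ω : Type) (_ : Field Ω) (_ : Algebra ℂ Ω) (_ : IsAlgClosed Ω) (v : Fin (r + 1) → Ω),
      (∀ g : MvPolynomial (Fin (r + 1)) ℂ, aeval v g = 0 ↔ g ∈ II X) ∧
      Algebra.IsAlgebraic (Algebra.adjoin ℂ (Set.range v)) Ω := by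
  haveI := II_isPrime hX
  let R := MvPolynomial (Fin (r + 1)) ℂ ⧸ II X
  let x : Fin (r + 1) → R := fun i => Ideal.Quotient.mk (II X) (MvPolynomial.X i)
  have hmk : ∀ g : MvPolynomial (Fin (r + 1)) ℂ, (Ideal.Quotient.mk (II X) g : R) = aeval x g := by
    intro g
    have : Ideal.Quotient.mkₐ ℂ (II X) = aeval x := by ext i; simp [x]
    exact DFunLike.congr_fun this g
  refine exists_genericPoint_aux R x ?_ ?_
  · intro a
    obtain ⟨g, rfl⟩ := Ideal.Quotient.mk_surjective a
    exact ⟨g, (hmk g).symm⟩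
  · intro g
    rw [← hmk, Ideal.Quotient.eq_zero_iff_mem]

variable {r s : ℕ} {X : Set (Pt r)} {X' : Set (Pt s)}

lemma aeval_pull {A : Type*} [CommRing A] [Algebra ℂ A]
    (f : (Fin (s + 1) → ℂ) →ₗ[ℂ] (Fin (r + 1) → ℂ)) (g : MvPolynomial (Fin (r + 1)) ℂ)
    (v : Fin (s + 1) → A) :
    aeval v (pull f g) = aeval (fun i => aeval v (coordPoly f i)) g :=
  MvPolynomial.comp_aeval_apply _ (aeval v) g

/-- integrality at the polynomial level -/
lemma ProjData.integral_mem {f : (Fin (s + 1) → ℂ) →ₗ[ℂ] (Fin (r + 1) → ℂ)} (hd : ProjData f X' X)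
    (l : (Fin (s + 1) → ℂ) →ₗ[ℂ] ℂ) :
    ∃ P : Polynomial (MvPolynomial (Fin (r + 1)) ℂ), P.Monic ∧
      Polynomial.eval₂ (pull f).toRingHom (linPoly l) P ∈ II X' := by
  obtain ⟨P, hP, h⟩ := hd.integral l
  refine ⟨P, hP, (mem_II_iff hd.irr'.1 _).2 fun v hv => ?_⟩
  have := h v hv
  have he : eval (f v) = (eval v).comp (pull f).toRingHom :=
    RingHom.ext fun a => (eval_pull f a v).symm
  rw [Polynomial.hom_eval₂, ← he, eval_linPoly]
  exact this

lemma ProjData.rational {f : (Fin (s + 1) → ℂ) →ₗ[ℂ] (Fin (r + 1) → ℂ)} (hd : ProjData f X' X)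
    (l : (Fin (s + 1) → ℂ) →ₗ[ℂ] ℂ) :
    ∃ N D : MvPolynomial (Fin (r + 1)) ℂ, D ∉ II X ∧
      ∀ v ∈ Cone X', eval (f v) D * l v = eval (f v) N := by
  obtain ⟨Ω, _, _, _, v, hgen, halg⟩ := exists_genericPoint hd.irr'
  let u : Fin (r + 1) → Ω := fun i => aeval v (coordPoly f i)
  let k := IntermediateField.adjoin ℂ (Set.range u)
  have hk : ∀ i, u i ∈ k := fun i => IntermediateField.subset_adjoin _ _ ⟨i, rfl⟩
  have hkp : ∀ g : MvPolynomial (Fin (r + 1)) ℂ, aeval u g ∈ k := by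
    intro g
    have := MvPolynomial.comp_aeval_apply (fun i => (⟨u i, hk i⟩ : k)) k.val g
    have h2 : aeval u g = k.val (aeval (fun i => (⟨u i, hk i⟩ : k)) g) := this.symm
    rw [h2]
    exact (aeval (fun i => (⟨u i, hk i⟩ : k)) g).2
  have hIntg : ∀ j, IsAlgebraic k (v j) := by
    intro j
    obtain ⟨P, hP, hmem⟩ := hd.integral_mem (LinearMap.proj j)
    have h1 := (hgen _).2 hmem
    have hlin : linPoly (LinearMap.proj j : (Fin (s + 1) → ℂ) →ₗ[ℂ] ℂ) = MvPolynomial.X j := by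
      refine MvPolynomial.funext fun w => ?_
      rw [eval_linPoly]; simp
    rw [hlin] at h1
    have h2 : Polynomial.eval₂ (((aeval v : MvPolynomial (Fin (s + 1)) ℂ →ₐ[ℂ] Ω) :
        MvPolynomial (Fin (s + 1)) ℂ →+* Ω).comp (pull f).toRingHom) (v j) P = 0 := by
      have h3 := Polynomial.hom_eval₂ P (pull f).toRingHom ((aeval v : MvPolynomial (Fin (s + 1)) ℂ →ₐ[ℂ] Ω) :
        MvPolynomial (Fin (s + 1)) ℂ →+* Ω) (MvPolynomial.X j)
      have h4 : ((aeval v : MvPolynomial (Fin (s + 1)) ℂ →ₐ[ℂ] Ω) :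
        MvPolynomial (Fin (s + 1)) ℂ →+* Ω) (MvPolynomial.X j) = v j := by simp
      rw [h4] at h3
      rw [← h3]; exact h1
    let ψ : MvPolynomial (Fin (r + 1)) ℂ →+* k :=
      ((aeval u : MvPolynomial (Fin (r + 1)) ℂ →ₐ[ℂ] Ω) : MvPolynomial (Fin (r + 1)) ℂ →+* Ω).codRestrict
        k.toSubring hkp
    refine ⟨P.map ψ, (hP.map ψ).ne_zero, ?_⟩
    rw [Polynomial.aeval_def, Polynomial.eval₂_map]
    have : (algebraMap k Ω).comp ψ = ((aeval v : MvPolynomial (Fin (s + 1)) ℂ →ₐ[ℂ] Ω) :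
        MvPolynomial (Fin (s + 1)) ℂ →+* Ω).comp (pull f).toRingHom :=
      RingHom.ext fun g => (aeval_pull f g v).symm
    rw [this]; exact h2
  haveI : Algebra.IsAlgebraic k Ω := by
    let K := (algebraicClosure k Ω).restrictScalars ℂ
    have hKmem : ∀ x : Ω, x ∈ K ↔ IsAlgebraic k x := fun x => mem_algebraicClosure_iff
    have hK : ∀ x : Ω, IsAlgebraic K x → x ∈ K := by
      intro x hx
      rw [hKmem]
      have hx' : IsAlgebraic (algebraicClosure k Ω) x := hx
      exact hx'.restrictScalars k
    refine ⟨fun x => ?_⟩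
    rw [← hKmem]
    apply hK
    have hle : Algebra.adjoin ℂ (Set.range v) ≤ K.toSubalgebra := by
      rw [Algebra.adjoin_le_iff]
      rintro _ ⟨i, rfl⟩
      exact (hKmem _).2 (hIntg i)
    exact (halg.1 x).tower_top_of_subalgebra_le hle
  obtain ⟨h0, hh0, hinj⟩ := hd.inj
  have hpt : PtOver X' v := fun g hg => (hgen g).2 hg
  have hmem : aeval v (linPoly l) ∈ k := by
    have : aeval v (linPoly l) ∈ (⊥ : IntermediateField k Ω) := by
      haveI : IsAlgClosure k Ω := ⟨inferInstance, inferInstance⟩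
      haveI : Normal k Ω := IsAlgClosure.normal k Ω
      haveI : IsGalois k Ω := IsGalois.mk
      rw [InfiniteGalois.mem_bot_iff_fixed]
      intro σ
      have h1 : ∀ (g : MvPolynomial (Fin (s + 1)) ℂ), σ (aeval v g) = aeval (fun i => σ (v i)) g := by
        intro g
        exact MvPolynomial.comp_aeval_apply v ((AlgEquiv.restrictScalars ℂ σ : Ω ≃ₐ[ℂ] Ω) : Ω →ₐ[ℂ] Ω) g
      by_contra hne
      rw [h1] at hne
      have hu : ∀ i, aeval (fun i => σ (v i)) (coordPoly f i) = aeval v (coordPoly f i) := by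
        intro i
        rw [← h1]
        exact σ.commutes ⟨_, hk i⟩
      have hpt2 : PtOver X' (fun i => σ (v i)) := hpt.map ((AlgEquiv.restrictScalars ℂ σ : Ω ≃ₐ[ℂ] Ω) : Ω →ₐ[ℂ] Ω)
      have ha : aeval v h0 ≠ 0 := fun h => hh0 ((hgen _).1 h)
      have hb : aeval (fun i => σ (v i)) h0 ≠ 0 := by
        rw [← h1]; exact (map_ne_zero_iff _ σ.injective).2 ha
      have hc : aeval (fun i => σ (v i)) (linPoly l) - aeval v (linPoly l) ≠ 0 := sub_ne_zero.2 hne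
      obtain ⟨B, hB, ⟨θ⟩⟩ := spec_exists (Set.range v ∪ Set.range (fun i => σ (v i)) ∪
        {(aeval v h0)⁻¹, (aeval (fun i => σ (v i)) h0)⁻¹,
          (aeval (fun i => σ (v i)) (linPoly l) - aeval v (linPoly l))⁻¹})
        (((Set.finite_range _).union (Set.finite_range _)).union (by simp))
      let v1 : Fin (s + 1) → B := fun i => ⟨v i, hB (Or.inl (Or.inl ⟨i, rfl⟩))⟩
      let v2 : Fin (s + 1) → B := fun i => ⟨σ (v i), hB (Or.inl (Or.inr ⟨i, rfl⟩))⟩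
      have unit : ∀ b : B, (b : Ω) ≠ 0 → (b : Ω)⁻¹ ∈ B → θ b ≠ 0 := by
        intro b hb hbi h
        have : b * ⟨_, hbi⟩ = 1 := Subtype.ext (mul_inv_cancel₀ hb)
        have := congrArg θ this
        rw [map_mul, h, zero_mul, map_one] at this
        exact zero_ne_one this
      have e1 := aeval_spec θ v1
      have e2 := aeval_spec θ v2
      have key := hinj _ (PtOver.spec hd.irr'.2.1 θ v1 hpt) _ (PtOver.spec hd.irr'.2.1 θ v2 hpt2)
        (by
          rw [(e1 h0).1]
          refine unit _ ?_ ?_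
          · rw [(e1 h0).2]; exact ha
          · rw [(e1 h0).2]; exact hB (Or.inr (by simp [v1])))
        (by
          rw [(e2 h0).1]
          refine unit _ ?_ ?_
          · rw [(e2 h0).2]; exact hb
          · rw [(e2 h0).2]; exact hB (Or.inr (by simp [v2])))
        (by
          ext i
          have hf : ∀ w : Fin (s + 1) → ℂ, f w i = eval w (coordPoly f i) := fun w =>
            (eval_linPoly ((LinearMap.proj i).comp f) w).symm
          rw [hf, hf, (e1 _).1, (e2 _).1]
          congr 1
          apply Subtype.ext
          rw [(e1 _).2, (e2 _).2]
          exact (hu i).symm)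
      have hcon : θ (aeval v2 (linPoly l) - aeval v1 (linPoly l)) ≠ 0 := by
        refine unit _ ?_ ?_
        · rw [AddSubgroupClass.coe_sub, (e1 _).2, (e2 _).2]; exact hc
        · rw [AddSubgroupClass.coe_sub, (e1 _).2, (e2 _).2]; exact hB (Or.inr (by simp [v1, v2]))
      apply hcon
      rw [map_sub, ← (e1 _).1, ← (e2 _).1, key, sub_self]
    rw [IntermediateField.mem_bot] at this
    obtain ⟨y, hy⟩ := this
    rw [← hy]; exact y.2
  rw [IntermediateField.mem_adjoin_range_iff] at hmem
  obtain ⟨N0, D0, hND⟩ := hmem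
  obtain ⟨N, D, hD, hND⟩ : ∃ N D : MvPolynomial (Fin (r + 1)) ℂ, aeval u D ≠ 0 ∧
      aeval v (linPoly l) = aeval u N / aeval u D := by
    by_cases hD : aeval u D0 = 0
    · exact ⟨0, 1, by simp, by rw [hND, hD]; simp⟩
    · exact ⟨N0, D0, hD, hND⟩
  rw [eq_div_iff hD] at hND
  have hpu : ∀ g : MvPolynomial (Fin (r + 1)) ℂ, aeval u g = aeval v (pull f g) := fun g =>
    (aeval_pull f g v).symm
  refine ⟨N, D, ?_, ?_⟩
  · intro hDX
    apply hD
    rw [hpu, hgen, mem_II_iff hd.irr'.1]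
    intro w hw
    rw [eval_pull]
    exact (mem_II_iff hd.irr.1 _).1 hDX _ (hd.map w hw)
  · intro w hw
    have h1 : aeval v (pull f D * linPoly l - pull f N) = 0 := by
      rw [map_sub, map_mul, ← hpu, ← hpu]; linear_combination hND
    have := (mem_II_iff hd.irr'.1 _).1 ((hgen _).1 h1) w hw
    rw [map_sub, map_mul, eval_pull, eval_pull, eval_linPoly] at this
    exact sub_eq_zero.1 this

end ProjGeo
end

section
namespace ProjGeo

lemma normal_aux {S A : Type} [CommRing S] [CommRing A] [IsDomain A] (mk : S →+* A)
    (hmk : Function.Surjective mk) (M : Submonoid A) (hM : M ≤ nonZeroDivisors A)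
    (hn : integralClosure (Localization M) (FractionRing (Localization M)) = ⊥)
    (N D : S) (hD : mk D ≠ 0) (Q : Polynomial S) (hQm : Q.Monic)
    (hQ : mk (Polynomial.eval N (Q.scaleRoots D)) = 0) :
    ∃ a b : S, mk b ∈ M ∧ mk (b * N - a * D) = 0 := by
  haveI : IsDomain (Localization M) := IsLocalization.isDomain_localization hM
  let i1 := algebraMap A (Localization M)
  have hi1 : Function.Injective i1 := IsLocalization.injective _ hM
  let i2 := algebraMap (Localization M) (FractionRing (Localization M))
  have hi2 : Function.Injective i2 := IsFractionRing.injective _ _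
  let F : S →+* FractionRing (Localization M) := i2.comp (i1.comp mk)
  have hF : ∀ a, F a = 0 → mk a = 0 := by
    intro a ha
    exact (map_eq_zero_iff i1 hi1).1 ((map_eq_zero_iff i2 hi2).1 ha)
  have hFD : F D ≠ 0 := fun h => hD (hF _ h)
  have hx : F D * (F N / F D) = F N := mul_div_cancel₀ _ hFD
  have h1 : Polynomial.eval₂ F (F N / F D) Q = 0 := by
    have := Polynomial.scaleRoots_eval₂_mul (p := Q) F (F N / F D) D
    rw [hx, Polynomial.eval₂_at_apply] at this
    have h2 : F (Polynomial.eval N (Q.scaleRoots D)) = 0 := by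
      change i2 (i1 (mk _)) = 0
      rw [hQ, map_zero, map_zero]
    rw [h2] at this
    exact (mul_eq_zero.1 this.symm).resolve_left (pow_ne_zero _ hFD)
  have hIntg : IsIntegral (Localization M) (F N / F D) := by
    refine ⟨Q.map (i1.comp mk), hQm.map _, ?_⟩
    rw [Polynomial.eval₂_map]
    exact h1
  have hbot : F N / F D ∈ integralClosure (Localization M) (FractionRing (Localization M)) := hIntg
  rw [hn, Algebra.mem_bot] at hbot
  obtain ⟨y, hy⟩ := hbot
  obtain ⟨a, b, rfl⟩ := IsLocalization.exists_mk'_eq M y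
  obtain ⟨a, rfl⟩ := hmk a
  obtain ⟨b, hb⟩ := b
  obtain ⟨b, rfl⟩ := hmk b
  refine ⟨a, b, hb, hF _ ?_⟩
  have h3 : i1 (mk b) * IsLocalization.mk' (Localization M) (mk a) ⟨mk b, hb⟩ = i1 (mk a) := 
    IsLocalization.mk'_spec' (Localization M) (mk a) (⟨mk b, hb⟩ : M)
  have h4 := congrArg i2 h3
  rw [map_mul] at h4
  have h5 : F b * (F N / F D) = F a := by
    rw [← hy]; exact h4
  rw [map_sub, map_mul, map_mul, ← h5]
  field_simp
  ring

variable {r s : ℕ} {X : Set (Pt r)} {X' : Set (Pt s)}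

lemma normal_local (hX : IsIrrVar X) (hn : IsNormalVar X) (N D : MvPolynomial (Fin (r + 1)) ℂ)
    (hD : D ∉ II X) (Q : Polynomial (MvPolynomial (Fin (r + 1)) ℂ)) (hQm : Q.Monic)
    (hQ : Polynomial.eval N (Q.scaleRoots D) ∈ II X)
    (v0 : Fin (r + 1) → ℂ) (hv0 : v0 ∈ Cone X) (h0 : v0 ≠ 0) :
    ∃ a b : MvPolynomial (Fin (r + 1)) ℂ, eval v0 b ≠ 0 ∧ b * N - a * D ∈ II X := by
  haveI := II_isPrime hX
  haveI : IsDomain (coneRing X) := Ideal.Quotient.isDomain (II X)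
  let mk : MvPolynomial (Fin (r + 1)) ℂ →+* coneRing X := Ideal.Quotient.mk (II X)
  have hmk : ∀ a, mk a = 0 ↔ a ∈ II X := fun a => Ideal.Quotient.eq_zero_iff_mem
  have hz : ∀ g ∈ II X, eval v0 g = 0 := fun g hg => (mem_II_iff hX.1 g).1 hg v0 hv0
  let e : coneRing X →+* ℂ := Ideal.Quotient.lift (II X) (eval v0) hz
  have he : ∀ g, e (mk g) = eval v0 g := fun g => rfl
  have hP : (RingHom.ker e).IsPrime := RingHom.ker_isPrime e
  obtain ⟨i, hi⟩ := Function.ne_iff.1 h0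
  obtain ⟨a, b, hb, hab⟩ := normal_aux mk Ideal.Quotient.mk_surjective
    (@Ideal.primeCompl _ _ (RingHom.ker e) hP) (Ideal.primeCompl_le_nonZeroDivisors _)
    (hn (RingHom.ker e) hP ⟨i, fun h => hi (by
      have h' : e (mk (MvPolynomial.X i)) = 0 := h
      rw [he, eval_X] at h'
      exact h')⟩) N D (fun h => hD ((hmk _).1 h)) Q hQm ((hmk _).2 hQ)
  refine ⟨a, b, fun h => hb ?_, (hmk _).1 hab⟩
  exact (he b).trans h

lemma ProjData.regular {f : (Fin (s + 1) → ℂ) →ₗ[ℂ] (Fin (r + 1) → ℂ)} (hd : ProjData f X' X)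
    (hn : IsNormalVar X) (l : (Fin (s + 1) → ℂ) →ₗ[ℂ] ℂ)
    (v0 : Fin (r + 1) → ℂ) (hv0 : v0 ∈ Cone X) (h0 : v0 ≠ 0) :
    ∃ a b : MvPolynomial (Fin (r + 1)) ℂ, eval v0 b ≠ 0 ∧
      ∀ v ∈ Cone X', eval (f v) b * l v = eval (f v) a := by
  obtain ⟨N, D, hD, hND⟩ := hd.rational l
  obtain ⟨Q, hQm, hQ⟩ := hd.integral l
  obtain ⟨a, b, hb, hab⟩ := normal_local hd.irr hn N D hD Q hQm (by
    rw [mem_II_iff hd.irr.1]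
    intro u hu
    obtain ⟨v, hv, rfl⟩ := hd.surj u hu
    rw [← Polynomial.eval₂_at_apply, ← hND v hv, Polynomial.scaleRoots_eval₂_mul, hQ v hv,
      mul_zero]) v0 hv0 h0
  refine ⟨a, b, hb, ?_⟩
  have hD' : pull f D ∉ II X' := by
    intro h
    apply hD
    rw [mem_II_iff hd.irr.1]
    intro u hu
    obtain ⟨v, hv, rfl⟩ := hd.surj u hu
    rw [← eval_pull]
    exact (mem_II_iff hd.irr'.1 _).1 h v hv
  have := cone_dense hd.irr' (G := pull f b * linPoly l - pull f a) hD' (by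
    intro v hv hne
    rw [eval_pull] at hne
    rw [map_sub, map_mul, eval_pull, eval_pull, eval_linPoly]
    have h1 := (mem_II_iff hd.irr.1 _).1 hab _ (hd.map v hv)
    rw [map_sub, map_mul, map_mul, ← hND v hv] at h1
    refine (mul_eq_zero.1 (?_ : eval (f v) D * _ = 0)).resolve_left hne
    linear_combination h1)
  intro v hv
  have h1 := this v hv
  rw [map_sub, map_mul, eval_pull, eval_pull, eval_linPoly] at h1
  exact sub_eq_zero.1 h1

lemma ProjData.locReg {f : (Fin (s + 1) → ℂ) →ₗ[ℂ] (Fin (r + 1) → ℂ)} (hd : ProjData f X' X)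
    (hn : IsNormalVar X) (l : (Fin (s + 1) → ℂ) →ₗ[ℂ] ℂ) :
    ∃ φ, LocReg X φ ∧ ∀ v ∈ Cone X', φ (f v) = l v := by
  classical
  choose! p hp1 hp2 using hd.surj
  have hinj : ∀ v ∈ Cone X', ∀ w ∈ Cone X', f v = f w → l v = l w := by
    intro v hv w hw hvw
    by_cases h0 : f v = 0
    · have h1 : v = 0 := by by_contra h; exact hd.ne v hv h h0
      have h2 : w = 0 := by by_contra h; exact hd.ne w hw h (hvw ▸ h0)
      rw [h1, h2]
    · obtain ⟨a, b, hb, hab⟩ := hd.regular hn l (f v) (hd.map v hv) h0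
      have h1 := hab v hv
      have h2 := hab w hw
      rw [← hvw, ← h1] at h2
      exact (mul_left_cancel₀ hb h2).symm
  have key : ∀ v ∈ Cone X', l (p (f v)) = l v := fun v hv =>
    hinj _ (hp1 _ (hd.map v hv)) v hv (hp2 _ (hd.map v hv))
  refine ⟨fun u => l (p u), ⟨?_, ?_⟩, key⟩
  · intro v0 hv0 h0
    obtain ⟨a, b, hb, hab⟩ := hd.regular hn l v0 hv0 h0
    refine ⟨a, b, hb, fun u hu => ?_⟩
    have := hab (p u) (hp1 u hu)
    rw [hp2 u hu] at this
    exact this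
  · intro u hu c
    have := key (c • p u) (smul_mem_Cone (hp1 u hu) c)
    rw [map_smul, hp2 u hu, map_smul] at this
    exact this

end ProjGeo
end

section
namespace ProjGeo

/-- coordinate subspaces -/
def coordSub (r i : ℕ) : Submodule ℂ (Fin (r + 1) → ℂ) where
  carrier := {v | ∀ j : Fin (r + 1), i < j.val → v j = 0}
  zero_mem' := fun _ _ => rfl
  add_mem' := fun ha hb j hj => by simp [ha j hj, hb j hj]
  smul_mem' := fun c _ hb j hj => by simp [hb j hj]

lemma mk_mem_projSub {r : ℕ} {W : Submodule ℂ (Fin (r + 1) → ℂ)} {v : Fin (r + 1) → ℂ}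
    (hv : v ≠ 0) : Projectivization.mk ℂ v hv ∈ projSub W ↔ v ∈ W := by
  change (Projectivization.mk ℂ v hv).submodule ≤ W ↔ _
  rw [Projectivization.submodule_mk, Submodule.span_singleton_le_iff_mem]

lemma line_nonzero {r : ℕ} (x y : Fin (r + 1) → ℂ) (p q c : MvPolynomial (Fin (r + 1)) ℂ)
    (hp : eval x p ≠ 0) (hq : eval y q ≠ 0) (hc : eval x c ≠ 0) :
    ∃ t : ℂ, eval (x + t • (y - x)) p ≠ 0 ∧ eval (x + t • (y - x)) q ≠ 0 ∧
      eval (x + t • (y - x)) c ≠ 0 := by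
  let L : MvPolynomial (Fin (r + 1)) ℂ →ₐ[ℂ] Polynomial ℂ :=
    aeval (fun i => Polynomial.C (x i) + Polynomial.X * Polynomial.C (y i - x i))
  have hL : ∀ (g : MvPolynomial (Fin (r + 1)) ℂ) (t : ℂ),
      Polynomial.eval t (L g) = eval (x + t • (y - x)) g := by
    intro g t
    have := MvPolynomial.comp_aeval_apply
      (fun i => Polynomial.C (x i) + Polynomial.X * Polynomial.C (y i - x i)) (Polynomial.aeval t) g
    rw [← Polynomial.coe_aeval_eq_eval, ← coe_aeval_eq_eval]
    refine this.trans ?_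
    have h2 : (fun i => Polynomial.aeval t
      (Polynomial.C (x i) + Polynomial.X * Polynomial.C (y i - x i))) = x + t • (y - x) := by
      ext i; simp
    rw [h2]; rfl
  have h1 : L p ≠ 0 := fun h => hp (by have := hL p 0; rw [h] at this; simpa using this.symm)
  have h2 : L q ≠ 0 := fun h => hq (by have := hL q 1; rw [h] at this; simpa using this.symm)
  have h3 : L c ≠ 0 := fun h => hc (by have := hL c 0; rw [h] at this; simpa using this.symm)
  obtain ⟨t, ht⟩ : ∃ t, Polynomial.eval t (L p * L q * L c) ≠ 0 := by
    by_contra hcon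
    push Not at hcon
    exact mul_ne_zero (mul_ne_zero h1 h2) h3 (Polynomial.funext fun t => by rw [hcon t]; simp)
  rw [Polynomial.eval_mul, Polynomial.eval_mul, hL, hL, hL] at ht
  exact ⟨t, left_ne_zero_of_mul (left_ne_zero_of_mul ht),
    right_ne_zero_of_mul (left_ne_zero_of_mul ht), right_ne_zero_of_mul ht⟩

lemma not_mem_ZeroLocus {r : ℕ} {S : Set (MvPolynomial (Fin (r + 1)) ℂ)}
    (hS : ∀ p ∈ S, ∃ d, p.IsHomogeneous d) {v : Fin (r + 1) → ℂ} (hv : v ≠ 0) :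
    Projectivization.mk ℂ v hv ∉ ZeroLocus S ↔ ∃ p ∈ S, eval v p ≠ 0 := by
  constructor
  · intro h
    by_contra hcon
    push Not at hcon
    refine h fun p hp => ?_
    obtain ⟨d, hd⟩ := hS p hp
    exact (vanishesAt_iff hd v hv).2 (hcon p hp)
  · rintro ⟨p, hp, hne⟩ h
    exact hne (h p hp v hv rfl)

lemma coordSub_irr (r i : ℕ) : IsIrrVar (projSub (coordSub r i)) := by
  refine ⟨?_, ?_, ?_⟩
  · have h0 : (Pi.single 0 1 : Fin (r + 1) → ℂ) ≠ 0 := by simp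
    refine ⟨Projectivization.mk ℂ _ h0, (mk_mem_projSub h0).2 fun j hj => ?_⟩
    have : j ≠ 0 := by rintro rfl; simp at hj
    simp [this]
  · refine ⟨{p | ∃ j : Fin (r + 1), i < j.val ∧ p = MvPolynomial.X j}, ?_, ?_⟩
    · rintro _ ⟨j, _, rfl⟩
      exact ⟨1, isHomogeneous_X ℂ j⟩
    · ext x
      induction x using Projectivization.ind with
      | h v hv =>
        rw [mk_mem_projSub]
        constructor
        · rintro h _ ⟨j, hj, rfl⟩
          rw [vanishesAt_iff (isHomogeneous_X ℂ j), eval_X]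
          exact h j hj
        · intro h j hj
          have := h _ ⟨j, hj, rfl⟩ v hv rfl
          rwa [eval_X] at this
  · rintro _ _ ⟨S, hS, rfl⟩ ⟨T, hT, rfl⟩ hsub
    by_contra hcon
    push Not at hcon
    obtain ⟨h1, h2⟩ := hcon
    obtain ⟨x, hx, hxS⟩ := Set.not_subset.1 h1
    obtain ⟨y, hy, hyT⟩ := Set.not_subset.1 h2
    induction x using Projectivization.ind with
    | h v hv =>
    induction y using Projectivization.ind with
    | h w hw =>
    rw [mk_mem_projSub] at hx hy
    obtain ⟨p, hp, hpv⟩ := (not_mem_ZeroLocus hS hv).1 hxS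
    obtain ⟨q, hq, hqw⟩ := (not_mem_ZeroLocus hT hw).1 hyT
    obtain ⟨k, hk⟩ := Function.ne_iff.1 hv
    obtain ⟨t, ht1, ht2, ht3⟩ := line_nonzero v w p q (MvPolynomial.X k) hpv hqw (by simpa using hk)
    have h0 : v + t • (w - v) ≠ 0 := by
      intro h; rw [h] at ht3; simp at ht3
    rcases hsub ((mk_mem_projSub h0).2 (Submodule.add_mem _ hx
      (Submodule.smul_mem _ t (Submodule.sub_mem _ hy hx)))) with h | h
    · exact (not_mem_ZeroLocus hS h0).2 ⟨p, hp, ht1⟩ h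
    · exact (not_mem_ZeroLocus hT h0).2 ⟨q, hq, ht2⟩ h

lemma dimGE_univ {r m : ℕ} (h : m ≤ r) : DimGE (Set.univ : Set (Pt r)) m := by
  refine ⟨fun i => projSub (coordSub r i.val), fun i => ⟨coordSub_irr r i, Set.subset_univ _⟩, ?_⟩
  intro i j hij
  have hij' : i.val < j.val := hij
  rw [Set.ssubset_iff_of_subset]
  · have hj : j.val < r + 1 := by omega
    have h0 : (Pi.single ⟨j.val, hj⟩ 1 : Fin (r + 1) → ℂ) ≠ 0 := by simp
    refine ⟨Projectivization.mk ℂ _ h0, (mk_mem_projSub h0).2 fun k hk => ?_, ?_⟩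
    · have : k ≠ ⟨j.val, hj⟩ := by rintro rfl; simp at hk
      simp [this]
    · rw [mk_mem_projSub]
      intro hmem
      have := hmem ⟨j.val, hj⟩ hij'
      simp at this
  · intro x hx
    refine le_trans (show x.submodule ≤ _ from hx) fun v hv k hk => hv k (by omega)

lemma IsOADP.setup {n : ℕ} {X : Set (Pt (2 * n + 1))} (hX : IsOADP n X) : ∃ h, Setup X h := by
  obtain ⟨⟨hirr, hdim, hnd⟩, -, A, ⟨S, hS, rfl⟩, hA, hu⟩ := hX
  obtain ⟨x, -, hx⟩ := Set.not_subset.1 hA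
  induction x using Projectivization.ind with
  | h v hv =>
  obtain ⟨h, hhS, hhv⟩ := (not_mem_ZeroLocus hS hv).1 hx
  have huniq : UniqueSec X h := fun p hp hne =>
    hu _ ⟨trivial, (not_mem_ZeroLocus hS hp).2 ⟨h, hhS, hne⟩⟩
  refine ⟨h, hirr, hnd, by omega, huniq, ?_, ?_, ?_⟩
  · rintro rfl; simp at hhv
  · intro p hp
    by_cases hp0 : p = 0
    · exact ⟨0, zero_mem_Cone, 0, zero_mem_Cone, by simp [hp0]⟩
    obtain ⟨L, ⟨⟨x, hx, y, hy, -, rfl⟩, hL⟩, -⟩ := huniq p hp0 hp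
    induction x using Projectivization.ind with
    | h a ha =>
    induction y using Projectivization.ind with
    | h b hb =>
    rw [mk_mem_lineThrough, Submodule.mem_span_pair] at hL
    obtain ⟨c, d, hcd⟩ := hL
    exact ⟨c • a, smul_mem_Cone (fun _ => hx) c, d • b, smul_mem_Cone (fun _ => hy) d, hcd⟩
  · intro hbot
    apply hdim.2
    have : X = Set.univ := by
      rw [Set.eq_univ_iff_forall]
      intro x
      rw [mem_X_iff_rep]
      apply mem_Cone_of_II hirr.2.1
      intro g hg
      rw [hbot] at hg
      rw [(Submodule.mem_bot _).1 hg, map_zero]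
    rw [this]
    exact dimGE_univ (by omega)

theorem final_aux (n : ℕ) (X : Set (Pt (2 * n + 1)))
    (hX : IsOADP n X) (hnorm : IsNormalVar X) : GeomLinearlyNormal X := by
  intro r' hr X' hX' hnd f hf hbir
  obtain ⟨h, hs⟩ := hX.setup
  have hd := ProjData.mk' hX' hs.irr hbir
  have hker : LinearMap.ker f ≠ ⊥ := by
    intro hk
    have := LinearMap.finrank_le_finrank_of_injective (LinearMap.ker_eq_bot.1 hk)
    simp at this
    omega
  obtain ⟨v, hv, hv0⟩ := Submodule.exists_mem_ne_zero_of_ne_bot hker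
  obtain ⟨i, hi⟩ := Function.ne_iff.1 hv0
  obtain ⟨φ, hφ, hφl⟩ := hd.locReg hnorm (LinearMap.proj i)
  obtain ⟨m, hm⟩ := hφ.linear hs
  have h1 := nondeg_lin hnd (LinearMap.proj i - m.comp f) (by
    intro w hw
    rw [LinearMap.sub_apply, LinearMap.comp_apply, ← hm _ (hd.map w hw), hφl w hw, sub_self])
  have h2 := LinearMap.congr_fun h1 v
  rw [LinearMap.sub_apply, LinearMap.comp_apply, LinearMap.mem_ker.1 hv, map_zero, sub_zero] at h2
  exact hi h2

end ProjGeo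
end

namespace ProjGeo

theorem normal_oadp_geometrically_linearly_normal (n : ℕ) (X : Set (Pt (2 * n + 1)))
    (hX : IsOADP n X) (hnorm : IsNormalVar X) : GeomLinearlyNormal X := by
  exact final_aux n X hX hnorm

end ProjGeo
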